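/- arXiv:1702.02129 — 2 statements merged into one kernel-verified Lean document; each statement's English description precedes it below -/
import Mathlib

section
/- Let u be a classical solution of the parabolic differential inequality ∂u/∂t − Σ_{i,j=1}^n a_{ij}(x,u) ∂²u/∂x_i∂x_j + f(x,u,Du) ≤ 0 in ℝ₊^{n+1}, under the structural assumptions on a_{ij}, f, g, h, p. Suppose there exists a real number θ > 1 such that ∫₁^∞ r q(r) dr = ∞, ∫₁^∞ (g_θ(ζ) ζ)^{−1/2} dζ < ∞, and ∫₁^∞ dζ / h_θ(ζ) < ∞. Then lim_{t→∞} sup_{x∈K} u₊(x,t) = 0 for every compact set K ⊂ ℝⁿ, where u₊ = max(u, 0) is the positive part of u. -/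
open Set Filter MeasureTheory Metric

noncomputable section

/-- `n`-dimensional Euclidean space. -/
abbrev Eucl (n : ℕ) := EuclideanSpace ℝ (Fin n)

lemma Eucl.norm_le_norm_of_forall_abs_le {n : ℕ} {v w : Eucl n} (h : ∀ i, |w i| ≤ |v i|) :
    ‖w‖ ≤ ‖v‖ := by
  rw [EuclideanSpace.norm_eq, EuclideanSpace.norm_eq]
  refine Real.sqrt_le_sqrt (Finset.sum_le_sum fun i _ => ?_)
  simpa using sq_le_sq.2 (h i)

/-- If all partial derivatives exist everywhere and are continuous at `x₀`, then the function is
Fréchet differentiable at `x₀`. -/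
lemma Eucl.hasFDerivAt_of_partials {n : ℕ} {U : Eucl n → ℝ} {d : Eucl n → Fin n → ℝ}
    (hd : ∀ x i, HasDerivAt (fun s : ℝ => U (x + s • EuclideanSpace.single i (1 : ℝ))) (d x i) 0)
    {x₀ : Eucl n} (hc : ∀ i, ContinuousAt (fun x => d x i) x₀) :
    HasFDerivAt U (∑ i, d x₀ i • (EuclideanSpace.proj i : Eucl n →L[ℝ] ℝ)) x₀ := by
  have hline : ∀ (y : Eucl n) (i : Fin n) (s : ℝ),
      HasDerivAt (fun s : ℝ => U (y + s • EuclideanSpace.single i (1 : ℝ)))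
        (d (y + s • EuclideanSpace.single i (1 : ℝ)) i) s := by
    intro y i s
    have h1 : HasDerivAt (fun r : ℝ => U ((y + s • EuclideanSpace.single i (1 : ℝ)) +
        r • EuclideanSpace.single i (1 : ℝ))) (d (y + s • EuclideanSpace.single i (1 : ℝ)) i)
        (s - s) := by simpa using hd (y + s • EuclideanSpace.single i (1 : ℝ)) i
    have h2 := h1.comp_sub_const s s
    have e : ∀ r : ℝ, y + s • EuclideanSpace.single i (1 : ℝ) +
        (r - s) • EuclideanSpace.single i (1 : ℝ) = y + r • EuclideanSpace.single i (1 : ℝ) :=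
      fun r => by module
    simpa only [e] using h2
  rw [hasFDerivAt_iff_isLittleO_nhds_zero, Asymptotics.isLittleO_iff]
  intro c hcpos
  set ε : ℝ := c / (n + 1) with hε
  have hεpos : 0 < ε := by positivity
  have hev : ∀ᶠ x in nhds x₀, ∀ i, |d x i - d x₀ i| ≤ ε := by
    rw [eventually_all]
    intro i
    filter_upwards [Metric.continuousAt_iff'.1 (hc i) ε hεpos] with x hx
    exact (Real.dist_eq _ _ ▸ hx).le
  obtain ⟨δ, hδ, hball⟩ := Metric.eventually_nhds_iff.1 hev
  have hnear : ∀ v : Eucl n, ‖v‖ < δ → ∀ i, |d (x₀ + v) i - d x₀ i| ≤ ε := fun v hv =>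
    hball (by simpa [dist_eq_norm] using hv)
  have key : ∀ v : Eucl n, ‖v‖ < δ → ∀ s : Finset (Fin n),
      |U (x₀ + ∑ i ∈ s, v i • EuclideanSpace.single i (1 : ℝ)) - U x₀ - ∑ i ∈ s, v i * d x₀ i| ≤
        ε * ∑ i ∈ s, |v i| := by
    intro v hv s
    induction s using Finset.induction_on with
    | empty => simp
    | insert j s hj ih =>
      rw [Finset.sum_insert hj, Finset.sum_insert hj, Finset.sum_insert hj]
      set S : Eucl n := ∑ i ∈ s, v i • EuclideanSpace.single i (1 : ℝ) with hS
      have hSk : ∀ k, S k = if k ∈ s then v k else 0 := by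
        intro k
        simp [hS, Pi.single_apply]
      have hmv : |(U (x₀ + S + v j • EuclideanSpace.single j (1 : ℝ)) - v j * d x₀ j) -
          (U (x₀ + S + (0 : ℝ) • EuclideanSpace.single j (1 : ℝ)) - 0 * d x₀ j)| ≤
          ε * |v j - 0| := by
        refine Convex.norm_image_sub_le_of_norm_hasDerivWithin_le
          (f := fun r : ℝ => U (x₀ + S + r • EuclideanSpace.single j (1 : ℝ)) - r * d x₀ j)
          (f' := fun r => d (x₀ + S + r • EuclideanSpace.single j (1 : ℝ)) j - 1 * d x₀ j)
          (s := uIcc 0 (v j)) ?_ ?_ (convex_uIcc _ _) left_mem_uIcc right_mem_uIcc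
        · intro r _
          exact ((hline (x₀ + S) j r).sub ((hasDerivAt_id r).mul_const _)).hasDerivWithinAt
        · intro r hr
          rw [one_mul, add_assoc]
          refine hnear _ (lt_of_le_of_lt (Eucl.norm_le_norm_of_forall_abs_le fun k => ?_) hv) j
          have hr' : |r| ≤ |v j| := by
            simpa using abs_sub_left_of_mem_uIcc hr
          by_cases hkj : k = j
          · subst hkj
            simpa [hSk, hj] using hr'
          · by_cases hks : k ∈ s <;> simp [hSk, hks, hkj]
      have e1 : x₀ + (v j • EuclideanSpace.single j (1 : ℝ) + S) =
          x₀ + S + v j • EuclideanSpace.single j (1 : ℝ) := by abel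
      rw [e1]
      simp only [zero_smul, add_zero, zero_mul, sub_zero] at hmv
      rw [abs_le] at *
      constructor <;> linarith
  filter_upwards [Metric.ball_mem_nhds (0 : Eucl n) hδ] with v hv
  have hv' : ‖v‖ < δ := by simpa using hv
  have h1 := key v hv' Finset.univ
  have h2 : ∑ i, v i • EuclideanSpace.single i (1 : ℝ) = v := by
    ext k
    simp [Pi.single_apply]
  rw [h2] at h1
  have h3 : ∑ i, |v i| ≤ n * ‖v‖ := by
    calc ∑ i, |v i| ≤ ∑ _i : Fin n, ‖v‖ :=
          Finset.sum_le_sum fun i _ => by simpa using PiLp.norm_apply_le v i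
      _ = n * ‖v‖ := by simp
  have h4 : (∑ i, d x₀ i • (EuclideanSpace.proj i : Eucl n →L[ℝ] ℝ)) v =
      ∑ i, v i * d x₀ i := by
    simp [mul_comm]
  rw [h4, Real.norm_eq_abs]
  calc _ ≤ ε * ∑ i, |v i| := h1
    _ ≤ ε * (n * ‖v‖) := by gcongr
    _ ≤ ε * ((n + 1) * ‖v‖) := by gcongr; linarith
    _ = c * ‖v‖ := by rw [hε]; field_simp

/-- Second-order necessary condition for a local maximum on the real line. -/
lemma IsLocalMax.second_deriv_nonpos {φ φ' : ℝ → ℝ} {c s₀ : ℝ} (hmax : IsLocalMax φ s₀)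
    (h1 : ∀ s, HasDerivAt φ (φ' s) s) (h2 : HasDerivAt φ' c s₀) : c ≤ 0 := by
  by_contra! hc
  have hd : deriv φ = φ' := funext fun s => (h1 s).deriv
  have h0 : φ' s₀ = 0 := by rw [← hd]; exact hmax.deriv_eq_zero
  have hmin : IsLocalMin φ s₀ :=
    isLocalMin_of_deriv_deriv_pos (by rw [hd, h2.deriv]; exact hc) (by rw [hd, h0])
      (h1 s₀).continuousAt
  have hconst : φ =ᶠ[nhds s₀] fun _ => φ s₀ := by
    filter_upwards [hmax, hmin] with s ha hb using le_antisymm ha hb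
  have hd0 : φ' =ᶠ[nhds s₀] fun _ => 0 := by
    have := hconst.deriv
    rw [hd] at this
    simpa using this
  have : HasDerivAt φ' 0 s₀ := (hasDerivAt_const s₀ (0 : ℝ)).congr_of_eventuallyEq hd0
  exact hc.ne' (h2.unique this)

/-- First- and second-order necessary conditions at a local maximum of a function with continuous
partial derivatives up to order two. -/
lemma Eucl.isLocalMax_partials {n : ℕ} {F : Eucl n → ℝ} {dF : Eucl n → Fin n → ℝ}
    {d2F : Eucl n → Fin n → Fin n → ℝ}
    (hd : ∀ x i, HasDerivAt (fun s : ℝ => F (x + s • EuclideanSpace.single i (1 : ℝ))) (dF x i) 0)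
    (hd2 : ∀ x i j,
      HasDerivAt (fun s : ℝ => dF (x + s • EuclideanSpace.single j (1 : ℝ)) i) (d2F x i j) 0)
    (hc : ∀ i, Continuous fun x => dF x i) (hc2 : ∀ i j, Continuous fun x => d2F x i j)
    {x₀ : Eucl n} (hmax : IsLocalMax F x₀) :
    (∀ i, dF x₀ i = 0) ∧ (∀ i j, d2F x₀ i j = d2F x₀ j i) ∧
      ∀ ξ : Fin n → ℝ, ∑ i, ∑ j, d2F x₀ i j * ξ i * ξ j ≤ 0 := by
  have hF : ∀ x, HasFDerivAt F (∑ i, dF x i • (EuclideanSpace.proj i : Eucl n →L[ℝ] ℝ)) x :=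
    fun x => Eucl.hasFDerivAt_of_partials hd fun i => (hc i).continuousAt
  have hdF : ∀ i, HasFDerivAt (fun x => dF x i)
      (∑ j, d2F x₀ i j • (EuclideanSpace.proj j : Eucl n →L[ℝ] ℝ)) x₀ :=
    fun i => Eucl.hasFDerivAt_of_partials (fun x j => hd2 x i j) fun j => (hc2 i j).continuousAt
  have hF2 : HasFDerivAt (fun x => ∑ i, dF x i • (EuclideanSpace.proj i : Eucl n →L[ℝ] ℝ))
      (∑ i, (∑ j, d2F x₀ i j • (EuclideanSpace.proj j : Eucl n →L[ℝ] ℝ)).smulRight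
        (EuclideanSpace.proj i : Eucl n →L[ℝ] ℝ)) x₀ :=
    HasFDerivAt.fun_sum fun i _ => (hdF i).smul_const (EuclideanSpace.proj i : Eucl n →L[ℝ] ℝ)
  refine ⟨fun i => (IsLocalMax.hasDerivAt_eq_zero (f := fun s : ℝ =>
    F (x₀ + s • EuclideanSpace.single i (1 : ℝ))) (a := 0) ?_ (hd x₀ i)), fun i j => ?_,
    fun ξ => ?_⟩
  · have : ContinuousAt (fun s : ℝ => x₀ + s • EuclideanSpace.single i (1 : ℝ)) 0 := by fun_prop
    have h0 : x₀ + (0 : ℝ) • EuclideanSpace.single i (1 : ℝ) = x₀ := by simp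
    exact IsLocalMax.comp_continuous (g := fun s : ℝ => x₀ + s • EuclideanSpace.single i (1 : ℝ))
      (by rw [h0]; exact hmax) this
  · have := second_derivative_symmetric hF hF2 (EuclideanSpace.single j (1 : ℝ))
      (EuclideanSpace.single i (1 : ℝ))
    simpa [sum_apply, Pi.single_apply] using this
  · set v : Eucl n := WithLp.toLp 2 ξ with hv
    have hl : ∀ s : ℝ, HasDerivAt (fun s : ℝ => x₀ + s • v) v s := fun s => by
      simpa using ((hasDerivAt_id s).smul_const v).const_add x₀
    have h1 : ∀ s : ℝ, HasDerivAt (fun s : ℝ => F (x₀ + s • v)) (∑ i, dF (x₀ + s • v) i * ξ i) s := by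
      intro s
      have := (hF (x₀ + s • v)).comp_hasDerivAt s (hl s)
      simpa [sum_apply, hv, Function.comp_def] using this
    have h2 : HasDerivAt (fun s : ℝ => ∑ i, dF (x₀ + s • v) i * ξ i)
        (∑ i, (∑ j, d2F x₀ i j * ξ j) * ξ i) 0 := by
      refine HasDerivAt.fun_sum fun i _ => HasDerivAt.mul_const ?_ _
      have h0 : x₀ + (0 : ℝ) • v = x₀ := by simp
      have := HasFDerivAt.comp_hasDerivAt (l := fun x => dF x i) (f := fun s : ℝ => x₀ + s • v)
        (0 : ℝ) (by rw [h0]; exact hdF i) (hl 0)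
      simpa [sum_apply, hv, Function.comp_def] using this
    have h0 : x₀ + (0 : ℝ) • v = x₀ := by simp
    have hm : IsLocalMax (fun s : ℝ => F (x₀ + s • v)) 0 :=
      IsLocalMax.comp_continuous (g := fun s : ℝ => x₀ + s • v)
        (by rw [h0]; exact hmax) (hl 0).continuousAt
    have h3 := hm.second_deriv_nonpos h1 h2
    refine le_trans (le_of_eq ?_) h3
    refine Finset.sum_congr rfl fun i _ => ?_
    rw [Finset.sum_mul]
    exact Finset.sum_congr rfl fun j _ => by ring

open scoped MatrixOrder Matrix.Norms.L2Operator in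
/-- The trace pairing of a matrix with nonnegative quadratic form and a symmetric matrix with
nonpositive quadratic form is nonpositive. -/
lemma sum_mul_nonpos_of_forms {n : ℕ} {a H : Fin n → Fin n → ℝ}
    (ha : ∀ ξ : Fin n → ℝ, 0 ≤ ∑ i, ∑ j, a i j * ξ i * ξ j)
    (hsymm : ∀ i j, H i j = H j i)
    (hH : ∀ ξ : Fin n → ℝ, ∑ i, ∑ j, H i j * ξ i * ξ j ≤ 0) :
    ∑ i, ∑ j, a i j * H i j ≤ 0 := by
  have hpsd : (Matrix.of fun i j => -H i j).PosSemidef := by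
    refine Matrix.PosSemidef.of_dotProduct_mulVec_nonneg ?_ fun ξ => ?_
    · ext i j
      simp [Matrix.conjTranspose_apply, hsymm j i]
    · have := hH ξ
      simp only [dotProduct, Matrix.mulVec, Matrix.of_apply, Finset.mul_sum]
      have e : ∀ i j, star ξ i * (-H i j * ξ j) = -(H i j * ξ i * ξ j) := by
        intro i j
        simp
        ring
      simp only [e, Finset.sum_neg_distrib]
      linarith
  obtain ⟨B, hB⟩ := CStarAlgebra.nonneg_iff_eq_star_mul_self.1 hpsd.nonneg
  have hB' : ∀ i j, H i j = -∑ k, B k i * B k j := by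
    intro i j
    have := congrFun (congrFun hB i) j
    simp only [Matrix.of_apply, Matrix.mul_apply, Matrix.star_apply, star_trivial] at this
    linarith
  have hsum : ∑ i, ∑ j, a i j * H i j = -∑ k, ∑ i, ∑ j, a i j * B k i * B k j := by
    simp only [hB', mul_neg, Finset.sum_neg_distrib, Finset.mul_sum]
    congr 1
    rw [Finset.sum_comm (γ := Fin n) (s := Finset.univ) (t := Finset.univ)
      (f := fun k i => ∑ j, a i j * B k i * B k j)]
    refine Finset.sum_congr rfl fun i _ => ?_
    rw [Finset.sum_comm]
    exact Finset.sum_congr rfl fun k _ => Finset.sum_congr rfl fun j _ => by ring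
  rw [hsum, neg_nonpos]
  exact Finset.sum_nonneg fun k _ => ha fun i => B k i

/-- Gradient and second-order information at a point where a function is touched from above by a
radial function of `‖x‖ ^ 2`. -/
lemma Eucl.touching_radial {n : ℕ} {U : Eucl n → ℝ} {dU : Eucl n → Fin n → ℝ}
    {d2U : Eucl n → Fin n → Fin n → ℝ}
    (hd : ∀ x i, HasDerivAt (fun s : ℝ => U (x + s • EuclideanSpace.single i (1 : ℝ))) (dU x i) 0)
    (hd2 : ∀ x i j,
      HasDerivAt (fun s : ℝ => dU (x + s • EuclideanSpace.single j (1 : ℝ)) i) (d2U x i j) 0)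
    (hc : ∀ i, Continuous fun x => dU x i) (hc2 : ∀ i j, Continuous fun x => d2U x i j)
    {w w' w'' : ℝ → ℝ} (hw : ∀ s, HasDerivAt w (w' s) s) (hw' : ∀ s, HasDerivAt w' (w'' s) s)
    (hw'' : Continuous w'') {x₀ : Eucl n}
    (hmax : IsLocalMax (fun x => U x - w (‖x‖ ^ 2)) x₀) :
    (∀ i, dU x₀ i = 2 * w' (‖x₀‖ ^ 2) * x₀ i) ∧
      ∀ a : Fin n → Fin n → ℝ, (∀ ξ : Fin n → ℝ, 0 ≤ ∑ i, ∑ j, a i j * ξ i * ξ j) →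
        ∑ i, ∑ j, a i j * d2U x₀ i j ≤
          (∑ i, ∑ j, |a i j|) * (2 * |w' (‖x₀‖ ^ 2)| + 4 * (‖x₀‖ ^ 2 * |w'' (‖x₀‖ ^ 2)|)) := by
  have hsq : ∀ (x : Eucl n) (i : Fin n), HasDerivAt
      (fun s : ℝ => ‖x + s • EuclideanSpace.single i (1 : ℝ)‖ ^ 2) (2 * x i) 0 := by
    intro x i
    have h1 : HasDerivAt (fun s : ℝ => x + s • EuclideanSpace.single i (1 : ℝ))
        (EuclideanSpace.single i (1 : ℝ)) 0 := by
      simpa using ((hasDerivAt_id (0 : ℝ)).smul_const (EuclideanSpace.single i (1 : ℝ))).const_add x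
    simpa [EuclideanSpace.inner_single_right] using h1.norm_sq
  have hx0 : ∀ (x : Eucl n) (i : Fin n), x + (0 : ℝ) • EuclideanSpace.single i (1 : ℝ) = x := by
    simp
  have hcoord : ∀ (x : Eucl n) (i j : Fin n), HasDerivAt
      (fun s : ℝ => (x + s • EuclideanSpace.single j (1 : ℝ)) i) (if i = j then 1 else 0) 0 := by
    intro x i j
    have := ((hasDerivAt_id (0 : ℝ)).mul_const (if i = j then (1 : ℝ) else 0)).const_add (x i)
    simpa [Pi.single_apply] using this
  have hcomp : ∀ (v v' : ℝ → ℝ), (∀ s, HasDerivAt v (v' s) s) → ∀ (x : Eucl n) (i : Fin n),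
      HasDerivAt (fun s : ℝ => v (‖x + s • EuclideanSpace.single i (1 : ℝ)‖ ^ 2))
        (v' (‖x‖ ^ 2) * (2 * x i)) 0 := by
    intro v v' hv x i
    have := HasDerivAt.comp (0 : ℝ) (h₂ := v)
      (h := fun s : ℝ => ‖x + s • EuclideanSpace.single i (1 : ℝ)‖ ^ 2) (hv _) (hsq x i)
    simpa [hx0, Function.comp_def] using this
  have hw'c : Continuous w' := continuous_iff_continuousAt.2 fun s => (hw' s).continuousAt
  obtain ⟨hgrad, hsymm, hform⟩ := Eucl.isLocalMax_partials
    (F := fun x => U x - w (‖x‖ ^ 2))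
    (dF := fun x i => dU x i - w' (‖x‖ ^ 2) * (2 * x i))
    (d2F := fun x i j => d2U x i j - (w'' (‖x‖ ^ 2) * (2 * x j) * (2 * x i) +
      w' (‖x‖ ^ 2) * (2 * if i = j then 1 else 0)))
    (fun x i => (hd x i).sub (hcomp w w' hw x i))
    (fun x i j => (hd2 x i j).sub (by
      have := (hcomp w' w'' hw' x j).mul ((hcoord x i j).const_mul 2)
      simpa [hx0, Pi.mul_def] using this))
    (fun i => by have := hc i; fun_prop)
    (fun i j => by have := hc2 i j; fun_prop) hmax
  refine ⟨fun i => by linarith [hgrad i], fun a ha => ?_⟩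
  have htr := sum_mul_nonpos_of_forms ha hsymm hform
  have hle : ∀ i j, a i j * d2U x₀ i j - a i j * (d2U x₀ i j - (w'' (‖x₀‖ ^ 2) * (2 * x₀ j) *
      (2 * x₀ i) + w' (‖x₀‖ ^ 2) * (2 * if i = j then 1 else 0))) ≤
      |a i j| * (2 * |w' (‖x₀‖ ^ 2)| + 4 * (‖x₀‖ ^ 2 * |w'' (‖x₀‖ ^ 2)|)) := by
    intro i j
    have hi : |x₀ i| ≤ ‖x₀‖ := by simpa using PiLp.norm_apply_le x₀ i
    have hj : |x₀ j| ≤ ‖x₀‖ := by simpa using PiLp.norm_apply_le x₀ j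
    calc _ = a i j * (w'' (‖x₀‖ ^ 2) * (2 * x₀ j) * (2 * x₀ i) +
          w' (‖x₀‖ ^ 2) * (2 * if i = j then 1 else 0)) := by ring
      _ ≤ |a i j| * |w'' (‖x₀‖ ^ 2) * (2 * x₀ j) * (2 * x₀ i) +
          w' (‖x₀‖ ^ 2) * (2 * if i = j then 1 else 0)| := by
            rw [← abs_mul]; exact le_abs_self _
      _ ≤ _ := by
        refine mul_le_mul_of_nonneg_left ((abs_add_le _ _).trans ?_) (abs_nonneg _)
        have h1 : |w'' (‖x₀‖ ^ 2) * (2 * x₀ j) * (2 * x₀ i)| ≤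
            4 * (‖x₀‖ ^ 2 * |w'' (‖x₀‖ ^ 2)|) := by
          rw [abs_mul, abs_mul, abs_mul, abs_mul, abs_two]
          have : |x₀ j| * |x₀ i| ≤ ‖x₀‖ ^ 2 := by
            rw [sq]; exact mul_le_mul hj hi (abs_nonneg _) (norm_nonneg _)
          nlinarith [abs_nonneg (w'' (‖x₀‖ ^ 2))]
        have h2 : |w' (‖x₀‖ ^ 2) * (2 * if i = j then 1 else 0)| ≤ 2 * |w' (‖x₀‖ ^ 2)| := by
          split_ifs
          · rw [abs_mul]; norm_num; linarith
          · simp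
        linarith
  have hsum := Finset.sum_le_sum fun i (_ : i ∈ Finset.univ) =>
    Finset.sum_le_sum fun j (_ : j ∈ Finset.univ) => hle i j
  simp only [Finset.sum_sub_distrib, ← Finset.sum_mul] at hsum
  linarith

/-- A one-sided comparison of increments bounds the time derivative from below. -/
lemma HasDerivAt.neg_le_of_increment_le {φ : ℝ → ℝ} {d L t₀ : ℝ} (h : HasDerivAt φ d t₀)
    (hle : ∀ᶠ τ in nhdsWithin t₀ (Iio t₀), φ τ - φ t₀ ≤ L * (t₀ - τ)) : -L ≤ d := by
  have ht := (hasDerivAt_iff_tendsto_slope_left_right.1 h).1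
  refine ge_of_tendsto ht ?_
  filter_upwards [hle, self_mem_nhdsWithin] with τ h1 h2
  have h3 : τ - t₀ < 0 := sub_neg.2 h2
  rw [slope_def_field, le_div_iff_of_neg h3]
  linarith

/-- Classical solutions of `∂u/∂t − Σ aᵢⱼ(x,u) ∂²u/∂xᵢ∂xⱼ + f(x,u,Du) ≤ 0` in `ℝⁿ × (0,∞)`. -/
structure IsClassicalSubsolution {n : ℕ} (a : Eucl n → ℝ → Fin n → Fin n → ℝ)
    (f : Eucl n → ℝ → Eucl n → ℝ) (u : Eucl n → ℝ → ℝ) (du : Eucl n → ℝ → Eucl n)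
    (d2u : Eucl n → ℝ → Fin n → Fin n → ℝ) (ut : Eucl n → ℝ → ℝ) : Prop where
  hasDeriv : ∀ (x : Eucl n) (t : ℝ), 0 < t → ∀ i,
    HasDerivAt (fun s : ℝ => u (x + s • EuclideanSpace.single i (1 : ℝ)) t) (du x t i) 0
  hasDeriv₂ : ∀ (x : Eucl n) (t : ℝ), 0 < t → ∀ i j,
    HasDerivAt (fun s : ℝ => du (x + s • EuclideanSpace.single j (1 : ℝ)) t i) (d2u x t i j) 0
  hasDeriv_time : ∀ (x : Eucl n) (t : ℝ), 0 < t → HasDerivAt (fun τ : ℝ => u x τ) (ut x t) t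
  cont : ContinuousOn (fun q : Eucl n × ℝ => u q.1 q.2) (univ ×ˢ Ioi 0)
  cont_grad : ∀ i, ContinuousOn (fun q : Eucl n × ℝ => du q.1 q.2 i) (univ ×ˢ Ioi 0)
  cont_hess : ∀ i j, ContinuousOn (fun q : Eucl n × ℝ => d2u q.1 q.2 i j) (univ ×ˢ Ioi 0)
  ineq : ∀ (x : Eucl n) (t : ℝ), 0 < t →
    ut x t - (∑ i, ∑ j, a x (u x t) i j * d2u x t i j) + f x (u x t) (du x t) ≤ 0

/-- Ellipticity of `a` together with the lower bound on `f` along centred gradients. -/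
structure IsAbsorptionBound {n : ℕ} (a : Eucl n → ℝ → Fin n → Fin n → ℝ)
    (f : Eucl n → ℝ → Eucl n → ℝ) (g h : ℝ → ℝ) (p : Eucl n → ℝ) : Prop where
  elliptic : ∀ (x : Eucl n) (ζ : ℝ), ζ ≠ 0 → ∀ ξ : Eucl n, ξ ≠ 0 →
    0 < ∑ i, ∑ j, a x ζ i j * ξ i * ξ j
  le : ∀ (x : Eucl n) (ζ : ℝ), ζ ≠ 0 → ∀ lam : ℝ, 0 ≤ lam → lam ≤ p x * h |ζ| →
    p x * g |ζ| * (1 + ∑ i, ∑ j, |a x ζ i j|) ≤ f x ζ (lam • x) * Real.sign ζ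

lemma continuous_slice {n : ℕ} {v : Eucl n → ℝ → ℝ}
    (hv : ContinuousOn (fun q : Eucl n × ℝ => v q.1 q.2) (univ ×ˢ Ioi 0)) {t : ℝ} (ht : 0 < t) :
    Continuous fun x => v x t :=
  hv.comp_continuous (f := fun x : Eucl n => (x, t)) (by fun_prop) fun x => ⟨mem_univ _, ht⟩

/-- A positive subsolution cannot be touched from above by a radial strict supersolution. -/
lemma IsClassicalSubsolution.not_touching {n : ℕ} {a : Eucl n → ℝ → Fin n → Fin n → ℝ}
    {f : Eucl n → ℝ → Eucl n → ℝ} {g h : ℝ → ℝ} {p : Eucl n → ℝ}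
    {u : Eucl n → ℝ → ℝ} {du : Eucl n → ℝ → Eucl n}
    {d2u : Eucl n → ℝ → Fin n → Fin n → ℝ} {ut : Eucl n → ℝ → ℝ}
    (hu : IsClassicalSubsolution a f u du d2u ut) (hs : IsAbsorptionBound a f g h p)
    {w w' w'' : ℝ → ℝ} (hw : ∀ s, HasDerivAt w (w' s) s) (hw' : ∀ s, HasDerivAt w' (w'' s) s)
    (hw'' : Continuous w'') {x₀ : Eucl n} {t₀ L : ℝ} (ht₀ : 0 < t₀) (hpos : 0 < u x₀ t₀)
    (hmax : IsLocalMax (fun x => u x t₀ - w (‖x‖ ^ 2)) x₀)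
    (htime : ∀ᶠ τ in nhdsWithin t₀ (Iio t₀), u x₀ τ - u x₀ t₀ ≤ L * (t₀ - τ))
    (hw'_nonneg : 0 ≤ w' (‖x₀‖ ^ 2)) (hw'_le : 2 * w' (‖x₀‖ ^ 2) ≤ p x₀ * h (u x₀ t₀))
    (hw''_le : 2 * w' (‖x₀‖ ^ 2) + 4 * (‖x₀‖ ^ 2 * |w'' (‖x₀‖ ^ 2)|) ≤ p x₀ * g (u x₀ t₀))
    (hL : L < p x₀ * g (u x₀ t₀)) : False := by
  obtain ⟨hgrad, hhess⟩ := Eucl.touching_radial (U := fun x => u x t₀)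
    (dU := fun x i => du x t₀ i) (d2U := fun x i j => d2u x t₀ i j)
    (fun x i => hu.hasDeriv x t₀ ht₀ i) (fun x i j => hu.hasDeriv₂ x t₀ ht₀ i j)
    (fun i => continuous_slice (v := fun x t => du x t i) (hu.cont_grad i) ht₀)
    (fun i j => continuous_slice (v := fun x t => d2u x t i j) (hu.cont_hess i j) ht₀)
    hw hw' hw'' hmax
  have hdu : du x₀ t₀ = (2 * w' (‖x₀‖ ^ 2)) • x₀ := by
    ext i
    simpa using hgrad i
  have ha := hhess (a x₀ (u x₀ t₀)) fun ξ => by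
    by_cases hξ : (WithLp.toLp 2 ξ : Eucl n) = 0
    · have : ξ = 0 := by simpa using hξ
      simp [this]
    · exact (hs.elliptic x₀ _ hpos.ne' _ hξ).le
  have hf := hs.le x₀ _ hpos.ne' (2 * w' (‖x₀‖ ^ 2)) (by positivity) (by rwa [abs_of_pos hpos])
  rw [abs_of_pos hpos, Real.sign_of_pos hpos, mul_one, ← hdu] at hf
  have hut := (hu.hasDeriv_time x₀ t₀ ht₀).neg_le_of_increment_le htime
  have hineq := hu.ineq x₀ t₀ ht₀
  have hS : 0 ≤ ∑ i, ∑ j, |a x₀ (u x₀ t₀) i j| :=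
    Finset.sum_nonneg fun i _ => Finset.sum_nonneg fun j _ => abs_nonneg _
  rw [abs_of_nonneg hw'_nonneg] at ha
  have := mul_le_mul_of_nonneg_left hw''_le hS
  linarith

lemma Real.exists_smoothTransition_deriv_bounds :
    ∃ (η' η'' : ℝ → ℝ) (E : ℝ), 0 < E ∧ (∀ s, HasDerivAt Real.smoothTransition (η' s) s) ∧
      (∀ s, HasDerivAt η' (η'' s) s) ∧ Continuous η'' ∧ (∀ s, 0 ≤ η' s) ∧ (∀ s, η' s ≤ E) ∧
      (∀ s, |η'' s| ≤ E) ∧ ∀ s, s ∉ Ioo (0 : ℝ) 1 → η' s = 0 ∧ η'' s = 0 := by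
  have hcd : ContDiff ℝ 2 Real.smoothTransition := Real.smoothTransition.contDiff (n := 2)
  have hd : Differentiable ℝ Real.smoothTransition := hcd.differentiable (by norm_num)
  have hcd' : ContDiff ℝ 1 (deriv Real.smoothTransition) :=
    ((contDiff_succ_iff_deriv (n := 1)).1 (by rw [one_add_one_eq_two]; exact hcd)).2.2
  have hd' : Differentiable ℝ (deriv Real.smoothTransition) := hcd'.differentiable (by norm_num)
  have hc'' : Continuous (deriv (deriv Real.smoothTransition)) := hcd'.continuous_deriv_one
  have hclosed : ∀ {v : ℝ → ℝ}, Continuous v → (∀ s, s < 0 ∨ 1 < s → v s = 0) →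
      ∀ s, s ∉ Ioo (0 : ℝ) 1 → v s = 0 := by
    intro v hv h0 s hs
    have h1 : IsClosed {s | v s = 0} := isClosed_eq hv continuous_const
    rw [mem_Ioo, not_and_or, not_lt, not_lt] at hs
    rcases hs with hs | hs
    · exact closure_minimal (s := Iio 0) (fun r hr => h0 r (Or.inl hr)) h1 (by simpa using hs)
    · exact closure_minimal (s := Ioi 1) (fun r hr => h0 r (Or.inr hr)) h1 (by simpa using hs)
  have hz' : ∀ s : ℝ, s < 0 ∨ 1 < s → deriv Real.smoothTransition s = 0 := by
    rintro s (hs | hs)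
    · have : Real.smoothTransition =ᶠ[nhds s] fun _ => 0 := by
        filter_upwards [Iio_mem_nhds hs] with r hr using Real.smoothTransition.zero_of_nonpos hr.le
      simpa using this.deriv_eq
    · have : Real.smoothTransition =ᶠ[nhds s] fun _ => 1 := by
        filter_upwards [Ioi_mem_nhds hs] with r hr using Real.smoothTransition.one_of_one_le hr.le
      simpa using this.deriv_eq
  have hz'' : ∀ s : ℝ, s < 0 ∨ 1 < s → deriv (deriv Real.smoothTransition) s = 0 := by
    rintro s hs
    have : deriv Real.smoothTransition =ᶠ[nhds s] fun _ => 0 := by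
      rcases hs with hs | hs
      · filter_upwards [Iio_mem_nhds hs] with r hr using hz' r (Or.inl hr)
      · filter_upwards [Ioi_mem_nhds hs] with r hr using hz' r (Or.inr hr)
    simpa using this.deriv_eq
  have hbd : ∀ {v : ℝ → ℝ}, Continuous v → (∀ s, s ∉ Ioo (0 : ℝ) 1 → v s = 0) →
      ∃ C, ∀ s, |v s| ≤ C := by
    intro v hv h0
    obtain ⟨C, hC⟩ := (isCompact_Icc (a := (0 : ℝ)) (b := 1)).exists_bound_of_continuousOn
      hv.continuousOn
    refine ⟨C, fun s => ?_⟩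
    by_cases hs : s ∈ Ioo (0 : ℝ) 1
    · simpa using hC s (Ioo_subset_Icc_self hs)
    · rw [h0 s hs, abs_zero]
      exact (norm_nonneg _).trans (hC 0 (by simp))
  have hs' := hclosed hcd'.continuous hz'
  have hs'' := hclosed hc'' hz''
  obtain ⟨C₁, hC₁⟩ := hbd hcd'.continuous hs'
  obtain ⟨C₂, hC₂⟩ := hbd hc'' hs''
  refine ⟨deriv Real.smoothTransition, deriv (deriv Real.smoothTransition), max 1 (max C₁ C₂),
    by positivity, fun s => (hd s).hasDerivAt, fun s => (hd' s).hasDerivAt, hc'',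
    fun s => Real.smoothTransition.monotone.deriv_nonneg,
    fun s => (le_abs_self _).trans ((hC₁ s).trans (by simp)), fun s => (hC₂ s).trans (by simp),
    fun s hs => ⟨hs' s hs, hs'' s hs⟩⟩

/-- A nondecreasing `C²` function of `s = ‖x‖ ^ 2` whose derivatives are controlled by `p` on the
closed ball of radius `R`. -/
structure IsRadialClock {n : ℕ} (p : Eucl n → ℝ) (R : ℝ) (Φ Φ' Φ'' : ℝ → ℝ) : Prop where
  hasDeriv : ∀ s, HasDerivAt Φ (Φ' s) s
  hasDeriv₂ : ∀ s, HasDerivAt Φ' (Φ'' s) s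
  cont : Continuous Φ''
  nonneg : ∀ s, 0 ≤ Φ' s
  deriv_le : ∀ x : Eucl n, ‖x‖ ≤ R → Φ' (‖x‖ ^ 2) ≤ p x
  deriv₂_le : ∀ x : Eucl n, ‖x‖ ≤ R → ‖x‖ ^ 2 * |Φ'' (‖x‖ ^ 2)| ≤ p x
  deriv_sq_le : ∀ x : Eucl n, ‖x‖ ≤ R → ‖x‖ ^ 2 * Φ' (‖x‖ ^ 2) ^ 2 ≤ p x

/-- One step of the descent: an upper bound `b'` improves to `b` after shrinking the region by `D`
in the clock variable and by `d` in time. -/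
lemma IsClassicalSubsolution.level_descent {n : ℕ} {a : Eucl n → ℝ → Fin n → Fin n → ℝ}
    {f : Eucl n → ℝ → Eucl n → ℝ} {g h : ℝ → ℝ} {p : Eucl n → ℝ}
    {u : Eucl n → ℝ → ℝ} {du : Eucl n → ℝ → Eucl n}
    {d2u : Eucl n → ℝ → Fin n → Fin n → ℝ} {ut : Eucl n → ℝ → ℝ}
    (hu : IsClassicalSubsolution a f u du d2u ut) (hs : IsAbsorptionBound a f g h p)
    {R : ℝ} {Φ Φ' Φ'' : ℝ → ℝ} (hΦ : IsRadialClock p R Φ Φ' Φ'')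
    {η' η'' : ℝ → ℝ} {E : ℝ} (hη : ∀ s, HasDerivAt Real.smoothTransition (η' s) s)
    (hη' : ∀ s, HasDerivAt η' (η'' s) s) (hη'' : Continuous η'') (hη'_nonneg : ∀ s, 0 ≤ η' s)
    (hη'_le : ∀ s, η' s ≤ E) (hη''_le : ∀ s, |η'' s| ≤ E)
    {b b' D d c q₀ H G t₁ T : ℝ} (hb : 0 < b) (hbb' : b < b') (hD : 0 < D) (hd : 0 < d)
    (ht₁ : 0 < t₁) (hq₀ : ∀ x : Eucl n, ‖x‖ ≤ R → q₀ ≤ p x) (hR : c + D ≤ Φ (R ^ 2))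
    (hH : ∀ ζ ∈ Ioc b b', H ≤ h ζ) (hG : ∀ ζ ∈ Ioc b b', G ≤ g ζ) (hG0 : 0 ≤ G)
    (hDH : 2 * (b' - b) * E / D ≤ H) (hDG : (b' - b) * E * (6 / D + 4 / D ^ 2) ≤ G)
    (hdG : (b' - b) / d < q₀ * G)
    (hup : ∀ x : Eucl n, ‖x‖ ≤ R → Φ (‖x‖ ^ 2) ≤ c + D → ∀ t ∈ Icc t₁ T, u x t ≤ b') :
    ∀ x : Eucl n, ‖x‖ ≤ R → Φ (‖x‖ ^ 2) ≤ c → ∀ t ∈ Icc (t₁ + d) T, u x t ≤ b := by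
  intro x₁ hx₁R hx₁ t ht
  by_contra! hlt
  have hΦc : Continuous Φ := continuous_iff_continuousAt.2 fun s => (hΦ.hasDeriv s).continuousAt
  set w : ℝ → ℝ := fun s => (b' - b) * Real.smoothTransition ((Φ s - c) / D) with hw
  set ψ : ℝ → ℝ := fun τ => (b' - b) * max 0 ((t₁ + d - τ) / d) with hψ
  have hψc : Continuous ψ := by fun_prop
  have hwc : Continuous w := by
    have := Real.smoothTransition.continuous
    fun_prop
  have hψ0 : ∀ τ, 0 ≤ ψ τ := fun τ => mul_nonneg (by linarith) (le_max_left _ _)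
  have hw0 : ∀ s, 0 ≤ w s := fun s =>
    mul_nonneg (by linarith) (Real.smoothTransition.nonneg _)
  set C : Set (Eucl n × ℝ) :=
    (closedBall 0 R ∩ {x | Φ (‖x‖ ^ 2) ≤ c + D}) ×ˢ Icc t₁ T with hC
  have hCcomp : IsCompact C :=
    ((isCompact_closedBall _ _).inter_right
      (isClosed_le (by fun_prop) continuous_const)).prod isCompact_Icc
  have hmem : (x₁, t) ∈ C :=
    ⟨⟨by simpa using hx₁R, show Φ (‖x₁‖ ^ 2) ≤ c + D by linarith⟩, by linarith [ht.1], ht.2⟩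
  obtain ⟨⟨x₀, t₀⟩, hx₀C, hx₀max⟩ := hCcomp.exists_isMaxOn ⟨_, hmem⟩
    (f := fun q : Eucl n × ℝ => u q.1 q.2 - (b + w (‖q.1‖ ^ 2) + ψ q.2))
    ((hu.cont.mono fun q hq => ⟨mem_univ _, lt_of_lt_of_le ht₁ hq.2.1⟩).sub
      (by fun_prop))
  have hmax : ∀ x τ, ‖x‖ ≤ R → Φ (‖x‖ ^ 2) ≤ c + D → τ ∈ Icc t₁ T →
      u x τ - (b + w (‖x‖ ^ 2) + ψ τ) ≤ u x₀ t₀ - (b + w (‖x₀‖ ^ 2) + ψ t₀) :=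
    fun x τ h1 h2 h3 => hx₀max (show (x, τ) ∈ C from ⟨⟨by simpa using h1, h2⟩, h3⟩)
  obtain ⟨⟨hx₀R, hx₀Φ⟩, ht₀⟩ := hx₀C
  replace hx₀R : ‖x₀‖ ≤ R := by simpa using hx₀R
  replace hx₀Φ : Φ (‖x₀‖ ^ 2) ≤ c + D := hx₀Φ
  replace ht₀ : t₀ ∈ Icc t₁ T := ht₀
  have hgap : b + w (‖x₀‖ ^ 2) + ψ t₀ < u x₀ t₀ := by
    have h1 := hmax x₁ t hx₁R (by linarith) ⟨by linarith [ht.1], ht.2⟩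
    have h2 : w (‖x₁‖ ^ 2) = 0 := by
      rw [hw]
      simp only
      rw [Real.smoothTransition.zero_of_nonpos
        (div_nonpos_of_nonpos_of_nonneg (by linarith) hD.le), mul_zero]
    have h3 : ψ t = 0 := by
      rw [hψ]
      simp only
      rw [max_eq_left (div_nonpos_of_nonpos_of_nonneg (by linarith [ht.1]) hd.le), mul_zero]
    linarith
  have hub : u x₀ t₀ ≤ b' := hup x₀ hx₀R hx₀Φ t₀ ht₀
  have hΦlt : Φ (‖x₀‖ ^ 2) < c + D := by
    refine lt_of_le_of_ne hx₀Φ fun heq => ?_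
    have : w (‖x₀‖ ^ 2) = b' - b := by
      rw [hw]
      simp only
      rw [heq, add_sub_cancel_left, div_self hD.ne', Real.smoothTransition.one, mul_one]
    linarith [hψ0 t₀]
  have hRlt : ‖x₀‖ < R := by
    refine lt_of_le_of_ne hx₀R fun heq => ?_
    rw [heq] at hΦlt
    linarith
  have ht₀lt : t₁ < t₀ := by
    refine lt_of_le_of_ne ht₀.1 fun heq => ?_
    have : ψ t₀ = b' - b := by
      rw [hψ, ← heq]
      simp only
      rw [add_sub_cancel_left, div_self hd.ne', max_eq_right zero_le_one, mul_one]
    linarith [hw0 (‖x₀‖ ^ 2)]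
  have hζ : u x₀ t₀ ∈ Ioc b b' := ⟨by linarith [hψ0 t₀, hw0 (‖x₀‖ ^ 2)], hub⟩
  have hp : q₀ ≤ p x₀ := hq₀ x₀ hx₀R
  have hp1 := hΦ.deriv_le x₀ hx₀R
  have hp2 := hΦ.deriv₂_le x₀ hx₀R
  have hp3 := hΦ.deriv_sq_le x₀ hx₀R
  have hΦ0 := hΦ.nonneg (‖x₀‖ ^ 2)
  have hp0 : 0 ≤ p x₀ := hΦ0.trans hp1
  have hE : 0 ≤ E := (hη'_nonneg 0).trans (hη'_le 0)
  have hbb0 : 0 ≤ b' - b := by linarith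
  have hwd : ∀ s, HasDerivAt w ((b' - b) * (η' ((Φ s - c) / D) * (Φ' s / D))) s := fun s =>
    (HasDerivAt.comp s (hη _) (((hΦ.hasDeriv s).sub_const c).div_const D)).const_mul _
  have hwd2 : ∀ s, HasDerivAt (fun s => (b' - b) * (η' ((Φ s - c) / D) * (Φ' s / D)))
      ((b' - b) * (η'' ((Φ s - c) / D) * (Φ' s / D) * (Φ' s / D) +
        η' ((Φ s - c) / D) * (Φ'' s / D))) s := fun s =>
    ((HasDerivAt.comp s (hη' _) (((hΦ.hasDeriv s).sub_const c).div_const D)).mul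
      ((hΦ.hasDeriv₂ s).div_const D)).const_mul _
  have hΦ'c : Continuous Φ' := continuous_iff_continuousAt.2 fun s => (hΦ.hasDeriv₂ s).continuousAt
  have hη'c : Continuous η' := continuous_iff_continuousAt.2 fun s => (hη' s).continuousAt
  have hΦ''c := hΦ.cont
  set s₀ := ‖x₀‖ ^ 2 with hs₀
  have hs₀0 : 0 ≤ s₀ := by positivity
  set y := (Φ s₀ - c) / D
  have hw'0 : 0 ≤ (b' - b) * (η' y * (Φ' s₀ / D)) :=
    mul_nonneg hbb0 (mul_nonneg (hη'_nonneg _) (by positivity))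
  have hw'le : (b' - b) * (η' y * (Φ' s₀ / D)) ≤ (b' - b) * E / D * p x₀ := by
    calc _ ≤ (b' - b) * (E * (p x₀ / D)) := by
          gcongr
          exact hη'_le _
      _ = _ := by ring
  have hw''le : s₀ * |(b' - b) * (η'' y * (Φ' s₀ / D) * (Φ' s₀ / D) + η' y * (Φ'' s₀ / D))| ≤
      (b' - b) * E * (1 / D + 1 / D ^ 2) * p x₀ := by
    calc _ ≤ s₀ * ((b' - b) * (|η'' y| * (Φ' s₀ / D) * (Φ' s₀ / D) + η' y * (|Φ'' s₀| / D))) := by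
          rw [abs_mul, abs_of_nonneg hbb0]
          gcongr
          refine (abs_add_le _ _).trans (le_of_eq ?_)
          rw [abs_mul, abs_mul, abs_mul, abs_div, abs_div, abs_of_pos hD, abs_of_nonneg hΦ0,
            abs_of_nonneg (hη'_nonneg y)]
      _ = (b' - b) * (|η'' y| * (s₀ * Φ' s₀ ^ 2) / D ^ 2 + η' y * (s₀ * |Φ'' s₀|) / D) := by
          field_simp
      _ ≤ (b' - b) * (E * p x₀ / D ^ 2 + E * p x₀ / D) := by
          gcongr
          · exact hη''_le _
          · exact hη'_le _
      _ = _ := by ring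
  refine hu.not_touching hs hwd hwd2 (by fun_prop) (x₀ := x₀) (t₀ := t₀) (L := (b' - b) / d)
    (ht₁.trans ht₀lt) (hb.trans hζ.1) ?_ ?_ hw'0 ?_ ?_ ?_
  · have hopen : IsOpen {x : Eucl n | Φ (‖x‖ ^ 2) < c + D} :=
      isOpen_lt (by fun_prop) continuous_const
    have hopen' : IsOpen {x : Eucl n | ‖x‖ < R} := isOpen_lt continuous_norm continuous_const
    have hnhds : ∀ᶠ x in nhds x₀, ‖x‖ < R ∧ Φ (‖x‖ ^ 2) < c + D :=
      (hopen'.eventually_mem hRlt).and (hopen.eventually_mem hΦlt)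
    filter_upwards [hnhds] with x hx
    have := hmax x t₀ hx.1.le hx.2.le ht₀
    linarith
  · filter_upwards [Ioo_mem_nhdsLT ht₀lt] with τ hτ
    have h1 := hmax x₀ τ hx₀R hx₀Φ ⟨hτ.1.le, hτ.2.le.trans ht₀.2⟩
    have h2 : ψ τ - ψ t₀ ≤ (b' - b) / d * (t₀ - τ) := by
      have h3 : max 0 ((t₁ + d - τ) / d) ≤ max 0 ((t₁ + d - t₀) / d) + (t₀ - τ) / d := by
        refine max_le ?_ ?_
        · have : 0 ≤ (t₀ - τ) / d := div_nonneg (by linarith [hτ.2]) hd.le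
          linarith [le_max_left 0 ((t₁ + d - t₀) / d)]
        · have : (t₁ + d - τ) / d = (t₁ + d - t₀) / d + (t₀ - τ) / d := by ring
          linarith [le_max_right 0 ((t₁ + d - t₀) / d)]
      have := mul_le_mul_of_nonneg_left h3 hbb0
      calc ψ τ - ψ t₀ ≤ (b' - b) * ((t₀ - τ) / d) := by
            simp only [hψ]
            linarith
        _ = _ := by ring
    linarith
  · calc _ ≤ 2 * ((b' - b) * E / D * p x₀) := by gcongr
      _ = p x₀ * (2 * (b' - b) * E / D) := by ring
      _ ≤ _ := by
        gcongr
        exact hDH.trans (hH _ hζ)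
  · calc _ ≤ 2 * ((b' - b) * E / D * p x₀) +
          4 * ((b' - b) * E * (1 / D + 1 / D ^ 2) * p x₀) := by gcongr
      _ = p x₀ * ((b' - b) * E * (6 / D + 4 / D ^ 2)) := by ring
      _ ≤ _ := by
        gcongr
        exact hDG.trans (hG _ hζ)
  · calc _ < q₀ * G := hdG
      _ ≤ p x₀ * G := by gcongr
      _ ≤ _ := by
        gcongr
        exact hG _ hζ

/-- Iterating the descent: along levels `b k → ∞` with summable clock and time increments, a
subsolution is eventually below the lowest level, whatever its initial size. -/
lemma IsClassicalSubsolution.le_of_levels {n : ℕ} {a : Eucl n → ℝ → Fin n → Fin n → ℝ}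
    {f : Eucl n → ℝ → Eucl n → ℝ} {g h : ℝ → ℝ} {p : Eucl n → ℝ}
    {u : Eucl n → ℝ → ℝ} {du : Eucl n → ℝ → Eucl n}
    {d2u : Eucl n → ℝ → Fin n → Fin n → ℝ} {ut : Eucl n → ℝ → ℝ}
    (hu : IsClassicalSubsolution a f u du d2u ut) (hs : IsAbsorptionBound a f g h p)
    {R : ℝ} {Φ Φ' Φ'' : ℝ → ℝ} (hΦ : IsRadialClock p R Φ Φ' Φ'')
    {η' η'' : ℝ → ℝ} {E : ℝ} (hη : ∀ s, HasDerivAt Real.smoothTransition (η' s) s)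
    (hη' : ∀ s, HasDerivAt η' (η'' s) s) (hη'' : Continuous η'') (hη'_nonneg : ∀ s, 0 ≤ η' s)
    (hη'_le : ∀ s, η' s ≤ E) (hη''_le : ∀ s, |η'' s| ≤ E)
    {b D d H G : ℕ → ℝ} {q₀ : ℝ} (hb : ∀ k, 0 < b k) (hbb : ∀ k, b k < b (k + 1))
    (hb_top : Tendsto b atTop atTop) (hD : ∀ k, 0 < D k) (hd : ∀ k, 0 < d k)
    (hD_sum : Summable D) (hd_sum : Summable d) (hR : ∑' k, D k ≤ Φ (R ^ 2))
    (hq₀ : ∀ x : Eucl n, ‖x‖ ≤ R → q₀ ≤ p x)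
    (hH : ∀ k, ∀ ζ ∈ Ioc (b k) (b (k + 1)), H k ≤ h ζ)
    (hG : ∀ k, ∀ ζ ∈ Ioc (b k) (b (k + 1)), G k ≤ g ζ) (hG0 : ∀ k, 0 ≤ G k)
    (hDH : ∀ k, 2 * (b (k + 1) - b k) * E / D k ≤ H k)
    (hDG : ∀ k, (b (k + 1) - b k) * E * (6 / D k + 4 / D k ^ 2) ≤ G k)
    (hdG : ∀ k, (b (k + 1) - b k) / d k < q₀ * G k) :
    ∀ x : Eucl n, ‖x‖ ≤ R → Φ (‖x‖ ^ 2) ≤ 0 → ∀ t, 1 + ∑' k, d k ≤ t → u x t ≤ b 0 := by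
  intro x hx hΦx t ht
  have hcomp : IsCompact (closedBall (0 : Eucl n) R ×ˢ Icc (1 : ℝ) t) :=
    (isCompact_closedBall _ _).prod isCompact_Icc
  obtain ⟨M, hM⟩ := hcomp.exists_bound_of_continuousOn (f := fun q : Eucl n × ℝ => u q.1 q.2)
    (hu.cont.mono fun q hq => ⟨mem_univ _, lt_of_lt_of_le one_pos hq.2.1⟩)
  obtain ⟨N, hN⟩ := (hb_top.eventually_ge_atTop M).exists
  have htime : ∀ k, ∑ i ∈ Finset.range k, d i ≤ ∑' i, d i := fun k =>
    hd_sum.sum_le_tsum _ fun i _ => (hd i).le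
  have hclock : ∀ k, ∑ i ∈ Finset.range k, D i ≤ ∑' i, D i := fun k =>
    hD_sum.sum_le_tsum _ fun i _ => (hD i).le
  have key : ∀ m k, k + m = N → ∀ y : Eucl n, ‖y‖ ≤ R →
      Φ (‖y‖ ^ 2) ≤ ∑ i ∈ Finset.range k, D i →
      ∀ τ ∈ Icc (1 + ∑' i, d i - ∑ i ∈ Finset.range k, d i) t, u y τ ≤ b k := by
    intro m
    induction m with
    | zero =>
      intro k hk y hy _ τ hτ
      have h1 : (y, τ) ∈ closedBall (0 : Eucl n) R ×ˢ Icc (1 : ℝ) t :=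
        ⟨by simpa using hy, by linarith [hτ.1, htime k], hτ.2⟩
      have h2 : u y τ ≤ M := (le_abs_self _).trans (hM _ h1)
      rw [add_zero] at hk
      rw [hk]
      exact h2.trans hN
    | succ m ih =>
      intro k hk
      have h1 := ih (k + 1) (by omega)
      have hck := hclock (k + 1)
      have htk := htime (k + 1)
      rw [Finset.sum_range_succ] at hck htk
      rw [Finset.sum_range_succ, Finset.sum_range_succ] at h1
      have h2 := hu.level_descent hs hΦ hη hη' hη'' hη'_nonneg hη'_le hη''_le (hb k) (hbb k) (hD k)
        (hd k) (T := t) (t₁ := 1 + ∑' i, d i - (∑ i ∈ Finset.range k, d i + d k)) (by linarith) hq₀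
        (hck.trans hR) (hH k) (hG k) (hG0 k) (hDH k) (hDG k) (hdG k) h1
      have e : 1 + ∑' i, d i - (∑ i ∈ Finset.range k, d i + d k) + d k =
          1 + ∑' i, d i - ∑ i ∈ Finset.range k, d i := by ring
      rwa [e] at h2
  exact key N 0 (by simp) x hx (by simpa using hΦx) t ⟨by simpa using ht, le_rfl⟩

section Infimum

variable {n : ℕ} {p : Eucl n → ℝ}

lemma sInf_image_ball_le (hp : ∀ x, 0 ≤ p x) {r : ℝ} {x : Eucl n} (hx : ‖x‖ < r) :
    sInf (p '' ball (0 : Eucl n) r) ≤ p x :=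
  csInf_le ⟨0, by rintro _ ⟨y, _, rfl⟩; exact hp y⟩ ⟨x, by simpa using hx, rfl⟩

lemma sInf_image_ball_nonneg (hp : ∀ x, 0 ≤ p x) (r : ℝ) :
    0 ≤ sInf (p '' ball (0 : Eucl n) r) :=
  Real.sInf_nonneg (by rintro _ ⟨y, _, rfl⟩; exact hp y)

lemma sInf_image_ball_anti (hp : ∀ x, 0 ≤ p x) {r R : ℝ} (hr : 0 < r) (hrR : r ≤ R) :
    sInf (p '' ball (0 : Eucl n) R) ≤ sInf (p '' ball (0 : Eucl n) r) :=
  csInf_le_csInf ⟨0, by rintro _ ⟨y, _, rfl⟩; exact hp y⟩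
    ((nonempty_ball.2 hr).image p) (image_mono (ball_subset_ball hrR))

/-- Cauchy condensation of the divergence condition, with the terms truncated at `1`. -/
lemma not_summable_min_of_lintegral_eq_top (hp : ∀ x, 0 ≤ p x)
    (hq : ∫⁻ r in Ioi (1 : ℝ), ENNReal.ofReal (r * sInf (p '' ball (0 : Eucl n) r)) = ⊤) :
    ¬ Summable fun j : ℕ => min ((4 : ℝ) ^ j * sInf (p '' ball (0 : Eucl n) (2 ^ (j + 1)))) 1 := by
  intro hsum
  set q : ℝ → ℝ := fun r => sInf (p '' ball (0 : Eucl n) r) with hqdef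
  have h1 : Summable fun j : ℕ => (4 : ℝ) ^ j * q (2 ^ (j + 1)) := by
    refine hsum.congr_atTop ?_
    filter_upwards [hsum.tendsto_atTop_zero.eventually_lt_const zero_lt_one] with j hj
    exact min_eq_left (by simpa using (min_lt_iff.1 hj).resolve_right (lt_irrefl _) |>.le)
  have h2 : Summable fun j : ℕ => 2 * ((4 : ℝ) ^ j * q (2 ^ j)) := by
    refine Summable.mul_left _ ((summable_nat_add_iff 1).1 ?_)
    refine (h1.mul_left 4).congr fun j => ?_
    rw [pow_succ]
    ring
  have hcover : Ioi (1 : ℝ) ⊆ ⋃ j : ℕ, Ico ((2 : ℝ) ^ j) (2 ^ (j + 1)) := by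
    intro r hr
    obtain ⟨j, hj⟩ := exists_nat_pow_near (mem_Ioi.1 hr).le one_lt_two
    exact mem_iUnion.2 ⟨j, hj⟩
  have hbound : ∫⁻ r in Ioi (1 : ℝ), ENNReal.ofReal (r * q r) ≤
      ENNReal.ofReal (∑' j : ℕ, 2 * ((4 : ℝ) ^ j * q (2 ^ j))) := by
    rw [ENNReal.ofReal_tsum_of_nonneg (fun j => by
      have := sInf_image_ball_nonneg hp ((2 : ℝ) ^ j)
      positivity) h2]
    refine (lintegral_mono_set hcover).trans ((lintegral_iUnion_le _ _).trans ?_)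
    refine ENNReal.tsum_le_tsum fun j => ?_
    have h3 : ∀ r ∈ Ico ((2 : ℝ) ^ j) (2 ^ (j + 1)), ENNReal.ofReal (r * q r) ≤
        ENNReal.ofReal (2 ^ (j + 1) * q (2 ^ j)) := by
      intro r hr
      refine ENNReal.ofReal_le_ofReal ?_
      have h4 : q r ≤ q (2 ^ j) := sInf_image_ball_anti hp (by positivity) hr.1
      exact mul_le_mul hr.2.le h4 (sInf_image_ball_nonneg hp _) (by positivity)
    refine (setLIntegral_mono' measurableSet_Ico h3).trans ?_
    rw [setLIntegral_const, Real.volume_Ico, ← ENNReal.ofReal_mul (by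
      have := sInf_image_ball_nonneg hp ((2 : ℝ) ^ j)
      positivity)]
    refine ENNReal.ofReal_le_ofReal (le_of_eq ?_)
    rw [show (4 : ℝ) = 2 * 2 by norm_num, mul_pow, pow_succ]
    ring
  rw [hq] at hbound
  exact ENNReal.ofReal_ne_top (top_le_iff.1 hbound)

lemma sInf_image_ball_pos (hp : ∀ x, 0 ≤ p x)
    (hq : ∫⁻ r in Ioi (1 : ℝ), ENNReal.ofReal (r * sInf (p '' ball (0 : Eucl n) r)) = ⊤)
    {r : ℝ} (hr : 0 < r) : 0 < sInf (p '' ball (0 : Eucl n) r) := by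
  refine lt_of_le_of_ne (sInf_image_ball_nonneg hp r) fun h0 => ?_
  refine not_summable_min_of_lintegral_eq_top hp hq (summable_zero.congr_atTop ?_)
  have htop : Tendsto (fun j : ℕ => (2 : ℝ) ^ (j + 1)) atTop atTop :=
    (tendsto_pow_atTop_atTop_of_one_lt one_lt_two).comp (tendsto_add_atTop_nat 1)
  filter_upwards [htop.eventually_ge_atTop r] with j hj
  have h1 : sInf (p '' ball (0 : Eucl n) (2 ^ (j + 1))) = 0 :=
    le_antisymm ((sInf_image_ball_anti hp hr hj).trans h0.ge) (sInf_image_ball_nonneg hp _)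
  simp [h1]

/-- Clocks reaching any prescribed value `S` exist, even ones that start outside a given ball. -/
lemma exists_radialClock (hp : ∀ x, 0 ≤ p x)
    (hq : ∫⁻ r in Ioi (1 : ℝ), ENNReal.ofReal (r * sInf (p '' ball (0 : Eucl n) r)) = ⊤)
    (r₀ S : ℝ) :
    ∃ (R q₀ : ℝ) (Φ Φ' Φ'' : ℝ → ℝ), IsRadialClock p R Φ Φ' Φ'' ∧ r₀ ≤ R ∧
      (∀ x : Eucl n, ‖x‖ ≤ r₀ → Φ (‖x‖ ^ 2) ≤ 0) ∧ S ≤ Φ (R ^ 2) ∧ 0 < q₀ ∧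
      ∀ x : Eucl n, ‖x‖ ≤ R → q₀ ≤ p x := by
  obtain ⟨η', η'', E, hE, hη, hη', hη'', hη'0, hη'E, hη''E, hηz⟩ :=
    Real.exists_smoothTransition_deriv_bounds
  set q : ℝ → ℝ := fun r => sInf (p '' ball (0 : Eucl n) r) with hqdef
  set κ : ℕ → ℝ := fun j => min ((4 : ℝ) ^ j * q (2 ^ (j + 1))) 1 with hκ
  have hq0 : ∀ r, 0 ≤ q r := sInf_image_ball_nonneg hp
  have hκ0 : ∀ j, 0 ≤ κ j := fun j => le_min (mul_nonneg (by positivity) (hq0 _)) zero_le_one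
  have hκq : ∀ j, κ j ≤ 4 ^ j * q (2 ^ (j + 1)) := fun j => min_le_left _ _
  have hκ1 : ∀ j, κ j ≤ 1 := fun j => min_le_right _ _
  have htop2 : Tendsto (fun j : ℕ => (2 : ℝ) ^ j) atTop atTop :=
    tendsto_pow_atTop_atTop_of_one_lt one_lt_two
  obtain ⟨j₀, hj₀⟩ := (htop2.eventually_ge_atTop r₀).exists
  have hκtop := (not_summable_iff_tendsto_nat_atTop_of_nonneg hκ0).1
    (not_summable_min_of_lintegral_eq_top hp hq)
  obtain ⟨J, hJ, hJ₀⟩ := ((hκtop.eventually_ge_atTop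
    (S * E + ∑ i ∈ Finset.range j₀, κ i)).and (eventually_ge_atTop j₀)).exists
  set y : ℕ → ℝ → ℝ := fun j s => (s - 4 ^ j) / (3 * 4 ^ j) with hy
  have hyd : ∀ j s, HasDerivAt (y j) (1 / (3 * 4 ^ j)) s := fun j s =>
    ((hasDerivAt_id s).sub_const _).div_const _
  have hyc : ∀ j, Continuous (y j) := fun j => by fun_prop
  have hymem : ∀ j s, y j s ∈ Ioo (0 : ℝ) 1 ↔ s ∈ Ioo ((4 : ℝ) ^ j) (4 ^ (j + 1)) := by
    intro j s
    have h4 : (0 : ℝ) < 3 * 4 ^ j := by positivity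
    simp only [hy, mem_Ioo, lt_div_iff₀ h4, div_lt_iff₀ h4, pow_succ]
    constructor <;> rintro ⟨h1, h2⟩ <;> constructor <;> linarith
  have hyuniq : ∀ i j s, y i s ∈ Ioo (0 : ℝ) 1 → y j s ∈ Ioo (0 : ℝ) 1 → i = j := by
    intro i j s hi hj
    rw [hymem] at hi hj
    have h1 : (4 : ℝ) ^ i < 4 ^ (j + 1) := hi.1.trans hj.2
    have h2 : (4 : ℝ) ^ j < 4 ^ (i + 1) := hj.1.trans hi.2
    rw [pow_lt_pow_iff_right₀ (by norm_num)] at h1 h2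
    omega
  set Φ : ℝ → ℝ := fun s => ∑ j ∈ Finset.Ico j₀ J, κ j / E * Real.smoothTransition (y j s) with hΦ
  set Φ' : ℝ → ℝ := fun s => ∑ j ∈ Finset.Ico j₀ J, κ j / E * (η' (y j s) * (1 / (3 * 4 ^ j)))
    with hΦ'
  set Φ'' : ℝ → ℝ := fun s =>
    ∑ j ∈ Finset.Ico j₀ J, κ j / E * (η'' (y j s) * (1 / (3 * 4 ^ j)) * (1 / (3 * 4 ^ j))) with hΦ''
  have hcases : ∀ s, (Φ' s = 0 ∧ Φ'' s = 0) ∨ ∃ m, s ∈ Ioo ((4 : ℝ) ^ m) (4 ^ (m + 1)) ∧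
      Φ' s = κ m / E * (η' (y m s) * (1 / (3 * 4 ^ m))) ∧
      Φ'' s = κ m / E * (η'' (y m s) * (1 / (3 * 4 ^ m)) * (1 / (3 * 4 ^ m))) := by
    intro s
    by_cases hm : ∃ m ∈ Finset.Ico j₀ J, y m s ∈ Ioo (0 : ℝ) 1
    · obtain ⟨m, hmJ, hm⟩ := hm
      have hne : ∀ j, j ≠ m → η' (y j s) = 0 ∧ η'' (y j s) = 0 := fun j hj =>
        hηz _ fun h => hj (hyuniq j m s h hm)
      refine Or.inr ⟨m, (hymem m s).1 hm, ?_, ?_⟩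
      · exact Finset.sum_eq_single_of_mem m hmJ fun j _ hj => by simp [(hne j hj).1]
      · exact Finset.sum_eq_single_of_mem m hmJ fun j _ hj => by simp [(hne j hj).2]
    · push Not at hm
      exact Or.inl ⟨Finset.sum_eq_zero fun j hj => by simp [(hηz _ (hm j hj)).1],
        Finset.sum_eq_zero fun j hj => by simp [(hηz _ (hm j hj)).2]⟩
  have hterm : ∀ m s, κ m / E * (η' (y m s) * (1 / (3 * 4 ^ m))) ≤ κ m / (3 * 4 ^ m) := by
    intro m s
    calc _ ≤ κ m / E * (E * (1 / (3 * 4 ^ m))) := by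
          have := hκ0 m
          gcongr
          exact hη'E _
      _ = _ := by field_simp
  have hterm' : ∀ m s, |κ m / E * (η'' (y m s) * (1 / (3 * 4 ^ m)) * (1 / (3 * 4 ^ m)))| ≤
      κ m / (9 * (4 ^ m * 4 ^ m)) := by
    intro m s
    have h4 : (0 : ℝ) < 1 / (3 * 4 ^ m) := by positivity
    rw [abs_mul, abs_mul, abs_mul, abs_of_pos h4, abs_of_nonneg (div_nonneg (hκ0 m) hE.le)]
    calc _ ≤ κ m / E * (E * (1 / (3 * 4 ^ m)) * (1 / (3 * 4 ^ m))) := by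
          have := hκ0 m
          gcongr
          exact hη''E _
      _ = _ := by field_simp; norm_num
  have hnonneg : ∀ s, 0 ≤ Φ' s := fun s => Finset.sum_nonneg fun j _ =>
    mul_nonneg (div_nonneg (hκ0 j) hE.le) (mul_nonneg (hη'0 _) (by positivity))
  have hpq : ∀ (x : Eucl n) (m : ℕ), ‖x‖ ^ 2 ∈ Ioo ((4 : ℝ) ^ m) (4 ^ (m + 1)) →
      κ m ≤ 4 ^ m * p x := by
    intro x m hx
    refine (hκq m).trans (mul_le_mul_of_nonneg_left (sInf_image_ball_le hp ?_) (by positivity))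
    refine lt_of_pow_lt_pow_left₀ 2 (by positivity) (hx.2.trans_eq ?_)
    rw [← pow_mul, mul_comm, pow_mul]
    norm_num
  refine ⟨2 ^ J, q (2 ^ (J + 1)), Φ, Φ', Φ'', ⟨fun s => ?_, fun s => ?_, ?_, hnonneg, fun x _ => ?_,
    fun x _ => ?_, fun x _ => ?_⟩, hj₀.trans (pow_le_pow_right₀ one_le_two hJ₀), fun x hx => ?_, ?_,
    sInf_image_ball_pos hp hq (by positivity), fun x hx => ?_⟩
  · exact HasDerivAt.fun_sum fun j _ => (HasDerivAt.comp s (hη _) (hyd j s)).const_mul _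
  · exact HasDerivAt.fun_sum fun j _ =>
      ((HasDerivAt.comp s (hη' _) (hyd j s)).mul_const _).const_mul _
  · fun_prop
  · rcases hcases (‖x‖ ^ 2) with h0 | ⟨m, hm, h1, -⟩
    · rw [h0.1]; exact hp x
    · rw [h1]
      refine (hterm m _).trans ((div_le_iff₀ (by positivity)).2 ((hpq x m hm).trans ?_))
      nlinarith [mul_nonneg (pow_nonneg (zero_le_four (α := ℝ)) m) (hp x)]
  · rcases hcases (‖x‖ ^ 2) with h0 | ⟨m, hm, -, h2⟩
    · rw [h0.2]; simpa using hp x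
    · rw [h2]
      have h4 : (0 : ℝ) < 4 ^ m := by positivity
      have h5 : ‖x‖ ^ 2 ≤ 4 * 4 ^ m := by have := hm.2; rw [pow_succ (4 : ℝ) m] at this; linarith
      calc _ ≤ 4 * 4 ^ m * (κ m / (9 * (4 ^ m * 4 ^ m))) := by
            gcongr
            exact hterm' m _
        _ ≤ 4 * 4 ^ m * (4 ^ m * p x / (9 * (4 ^ m * 4 ^ m))) := by
            gcongr
            exact hpq x m hm
        _ = 4 / 9 * p x := by field_simp
        _ ≤ p x := by linarith [hp x]
  · rcases hcases (‖x‖ ^ 2) with h0 | ⟨m, hm, h1, -⟩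
    · rw [h0.1]; simpa using hp x
    · have h4 : (0 : ℝ) < 4 ^ m := by positivity
      have h5 : ‖x‖ ^ 2 ≤ 4 * 4 ^ m := by have := hm.2; rw [pow_succ (4 : ℝ) m] at this; linarith
      have h6 := hnonneg (‖x‖ ^ 2)
      rw [h1] at h6 ⊢
      have h7 : κ m ^ 2 ≤ 4 ^ m * p x := by
        have := hpq x m hm
        nlinarith [hκ0 m, hκ1 m]
      calc _ ≤ 4 * 4 ^ m * (κ m / (3 * 4 ^ m)) ^ 2 := by
            gcongr
            exact hterm m _
        _ = 4 * κ m ^ 2 / (9 * 4 ^ m) := by field_simp; norm_num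
        _ ≤ 4 * (4 ^ m * p x) / (9 * 4 ^ m) := by gcongr
        _ = 4 / 9 * p x := by field_simp
        _ ≤ p x := by linarith [hp x]
  · refine Finset.sum_nonpos fun j hj => ?_
    rw [Real.smoothTransition.zero_of_nonpos, mul_zero]
    refine div_nonpos_of_nonpos_of_nonneg (sub_nonpos.2 ?_) (by positivity)
    have h1 : ‖x‖ ≤ 2 ^ j :=
      hx.trans (hj₀.trans (pow_le_pow_right₀ one_le_two (Finset.mem_Ico.1 hj).1))
    calc ‖x‖ ^ 2 ≤ (2 ^ j) ^ 2 := by gcongr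
      _ = 4 ^ j := by rw [← pow_mul, mul_comm, pow_mul]; norm_num
  · have h1 : Φ ((2 ^ J) ^ 2) = (∑ j ∈ Finset.Ico j₀ J, κ j) / E := by
      rw [Finset.sum_div]
      refine Finset.sum_congr rfl fun j hj => ?_
      rw [Real.smoothTransition.one_of_one_le, mul_one]
      rw [hy]
      simp only
      rw [le_div_iff₀ (by positivity), one_mul, ← pow_mul, mul_comm J 2, pow_mul]
      have : (4 : ℝ) ^ (j + 1) ≤ 4 ^ J :=
        pow_le_pow_right₀ (by norm_num) (Finset.mem_Ico.1 hj).2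
      rw [pow_succ] at this
      norm_num
      linarith
    rw [h1, le_div_iff₀ hE, Finset.sum_Ico_eq_sub _ hJ₀]
    linarith
  · refine sInf_image_ball_le hp (hx.trans_lt ?_)
    exact pow_lt_pow_right₀ one_lt_two (Nat.lt_succ_self J)

end Infimum

section Levels

/-- Integral test along geometrically growing levels. -/
lemma summable_of_integrableOn_of_div_le {F : ℝ → ℝ} (hF : IntegrableOn F (Ioi 1)) {c ε : ℝ}
    (hc : 1 < c) (hε : 0 < ε) {β : ℕ → ℝ} (hβ : ∀ k, 0 ≤ β k)
    (hβF : ∀ k : ℕ, ∀ ζ ∈ Ioc (ε * c ^ k) (ε * c ^ (k + 1)), β k / (ε * c ^ k) ≤ F ζ) :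
    Summable β := by
  have hb : Monotone fun k : ℕ => ε * c ^ k :=
    (pow_right_mono₀ hc.le).const_mul hε.le
  have htop : Tendsto (fun k : ℕ => ε * c ^ k) atTop atTop :=
    (tendsto_pow_atTop_atTop_of_one_lt hc).const_mul_atTop hε
  obtain ⟨N, hN⟩ := (htop.eventually_ge_atTop 1).exists
  rw [← summable_nat_add_iff N]
  set s : ℕ → Set ℝ := fun k => Ioc (ε * c ^ (k + N)) (ε * c ^ (k + N + 1)) with hs
  have hsub : ∀ k, s k ⊆ Ioi 1 := fun k ζ hζ =>
    (hN.trans (hb (Nat.le_add_left N k))).trans_lt hζ.1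
  have hdisj : Pairwise (Function.onFun Disjoint s) := fun i j hij =>
    hb.pairwise_disjoint_on_Ioc_succ (fun h => hij (Nat.add_right_cancel h))
  have hsum : Summable fun k => ∫ ζ in s k, F ζ :=
    (hasSum_integral_iUnion (fun k => measurableSet_Ioc) hdisj
      (hF.mono_set (iUnion_subset hsub))).summable
  refine Summable.of_nonneg_of_le (fun k => hβ _) (fun k => ?_) (hsum.mul_left (c - 1)⁻¹)
  have h1 := setIntegral_ge_of_const_le (measurableSet_Ioc (a := ε * c ^ (k + N)))
    (by simp) (hβF (k + N)) (hF.mono_set (hsub k))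
  have hpos : 0 < ε * c ^ (k + N) := by positivity
  rw [inv_mul_eq_div, le_div_iff₀ (sub_pos.2 hc)]
  refine le_trans (le_of_eq ?_) h1
  rw [measureReal_def, Real.volume_Ioc, ENNReal.toReal_ofReal
    (sub_nonneg.2 (hb (Nat.le_succ _))), smul_eq_mul]
  simp only [Nat.succ_eq_add_one, pow_succ]
  field_simp

variable {φ : ℝ → ℝ} {θ : ℝ}

/-- The infimum over a window of ratio `c < θ` dominates `φ_θ` on that window. -/
lemma sInf_image_Ioo_le_sInf_image_Icc (hpos : ∀ s : ℝ, 0 < s → 0 < φ s)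
    (hinf : ∀ K : Set ℝ, IsCompact K → K ⊆ Ioi 0 → K.Nonempty → 0 < sInf (φ '' K))
    {b c ζ : ℝ} (hb : 0 < b) (hc : 1 < c) (hcθ : c < θ) (hζ : ζ ∈ Icc b (c * b)) :
    0 < sInf (φ '' Ioo (ζ / θ) (θ * ζ)) ∧
      sInf (φ '' Ioo (ζ / θ) (θ * ζ)) ≤ sInf (φ '' Icc b (c * b)) := by
  have hθ : 0 < θ := by linarith
  have hζ0 : 0 < ζ := hb.trans_le hζ.1
  have hsub : Icc b (c * b) ⊆ Ioo (ζ / θ) (θ * ζ) := by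
    intro z hz
    have h1 : c * b < θ * b := by gcongr
    refine ⟨(div_lt_iff₀ hθ).2 ?_, ?_⟩
    · nlinarith [hζ.2, hz.1]
    · nlinarith [hζ.1, hz.2]
  have hne : (Icc b (c * b)).Nonempty := ⟨ζ, hζ⟩
  have hpos' : Icc (ζ / θ) (θ * ζ) ⊆ Ioi 0 := fun z hz => (div_pos hζ0 hθ).trans_le hz.1
  have hbdd : BddBelow (φ '' Icc (ζ / θ) (θ * ζ)) :=
    ⟨0, by rintro _ ⟨z, hz, rfl⟩; exact (hpos z (hpos' hz)).le⟩
  refine ⟨(hinf _ isCompact_Icc hpos' (hne.mono (hsub.trans Ioo_subset_Icc_self))).trans_le ?_, ?_⟩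
  · exact csInf_le_csInf hbdd ((hne.mono hsub).image φ) (image_mono Ioo_subset_Icc_self)
  · exact csInf_le_csInf (hbdd.mono (image_mono Ioo_subset_Icc_self)) (hne.image φ)
      (image_mono hsub)

lemma sInf_image_Icc_le (hpos : ∀ s : ℝ, 0 < s → 0 < φ s) {b B ζ : ℝ} (hb : 0 < b)
    (hζ : ζ ∈ Icc b B) : sInf (φ '' Icc b B) ≤ φ ζ :=
  csInf_le ⟨0, by rintro _ ⟨z, hz, rfl⟩; exact (hpos z (hb.trans_le hz.1)).le⟩ ⟨ζ, hζ, rfl⟩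

lemma summable_div_sInf (hpos : ∀ s : ℝ, 0 < s → 0 < φ s)
    (hinf : ∀ K : Set ℝ, IsCompact K → K ⊆ Ioi 0 → K.Nonempty → 0 < sInf (φ '' K))
    (hint : IntegrableOn (fun ζ : ℝ => (sInf (φ '' Ioo (ζ / θ) (θ * ζ)))⁻¹) (Ioi 1))
    {c ε : ℝ} (hc : 1 < c) (hcθ : c < θ) (hε : 0 < ε) :
    Summable fun k : ℕ => ε * c ^ k / sInf (φ '' Icc (ε * c ^ k) (c * (ε * c ^ k))) := by
  have hb : ∀ k : ℕ, 0 < ε * c ^ k := fun k => by positivity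
  have hG : ∀ k : ℕ, 0 < sInf (φ '' Icc (ε * c ^ k) (c * (ε * c ^ k))) := fun k =>
    hinf _ isCompact_Icc (fun z hz => (hb k).trans_le hz.1)
      ⟨_, left_mem_Icc.2 (le_mul_of_one_le_left (hb k).le hc.le)⟩
  refine summable_of_integrableOn_of_div_le hint hc hε
    (fun k => div_nonneg (hb k).le (hG k).le) fun k ζ hζ => ?_
  obtain ⟨h1, h2⟩ := sInf_image_Ioo_le_sInf_image_Icc hpos hinf (hb k) hc hcθ
    ⟨hζ.1.le, hζ.2.trans_eq (by rw [pow_succ]; ring)⟩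
  rw [div_right_comm, div_self (hb k).ne', one_div]
  exact inv_anti₀ h1 h2

lemma summable_sqrt_div_sInf (hpos : ∀ s : ℝ, 0 < s → 0 < φ s)
    (hinf : ∀ K : Set ℝ, IsCompact K → K ⊆ Ioi 0 → K.Nonempty → 0 < sInf (φ '' K))
    (hint : IntegrableOn
      (fun ζ : ℝ => (Real.sqrt (sInf (φ '' Ioo (ζ / θ) (θ * ζ)) * ζ))⁻¹) (Ioi 1))
    {c ε : ℝ} (hc : 1 < c) (hcθ : c < θ) (hε : 0 < ε) :
    Summable fun k : ℕ =>
      √(ε * c ^ k / sInf (φ '' Icc (ε * c ^ k) (c * (ε * c ^ k)))) := by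
  have hb : ∀ k : ℕ, 0 < ε * c ^ k := fun k => by positivity
  have hG : ∀ k : ℕ, 0 < sInf (φ '' Icc (ε * c ^ k) (c * (ε * c ^ k))) := fun k =>
    hinf _ isCompact_Icc (fun z hz => (hb k).trans_le hz.1)
      ⟨_, left_mem_Icc.2 (le_mul_of_one_le_left (hb k).le hc.le)⟩
  have hc0 : 0 < √c := Real.sqrt_pos.2 (by linarith)
  refine (summable_mul_right_iff (inv_pos.2 hc0).ne').1
    (summable_of_integrableOn_of_div_le hint hc hε (fun k => by positivity) fun k ζ hζ => ?_)
  have hζ' : ζ ∈ Icc (ε * c ^ k) (c * (ε * c ^ k)) :=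
    ⟨hζ.1.le, hζ.2.trans_eq (by rw [pow_succ]; ring)⟩
  obtain ⟨h1, h2⟩ := sInf_image_Ioo_le_sInf_image_Icc hpos hinf (hb k) hc hcθ hζ'
  have hζ0 : 0 < ζ := (hb k).trans_le hζ'.1
  refine le_trans (le_of_eq ?_) (inv_anti₀ (Real.sqrt_pos.2 (mul_pos h1 hζ0))
    (Real.sqrt_le_sqrt (mul_le_mul h2 hζ'.2 hζ0.le (hG k).le)))
  have hGk := hG k
  have hbk := hb k
  generalize sInf (φ '' Icc (ε * c ^ k) (c * (ε * c ^ k))) = G at hGk ⊢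
  generalize ε * c ^ k = b at hbk ⊢
  have h3 := Real.sqrt_pos.2 hGk
  have h4 := Real.sqrt_pos.2 hbk
  rw [Real.sqrt_mul hGk.le, Real.sqrt_mul (by linarith : 0 ≤ c), Real.sqrt_div hbk.le,
    div_eq_iff hbk.ne']
  field_simp
  exact Real.sq_sqrt hbk.le

end Levels

/-- Under the integral conditions a subsolution eventually drops below any positive level,
uniformly on balls. -/
lemma IsClassicalSubsolution.exists_forall_le {n : ℕ} {a : Eucl n → ℝ → Fin n → Fin n → ℝ}
    {f : Eucl n → ℝ → Eucl n → ℝ} {g h : ℝ → ℝ} {p : Eucl n → ℝ}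
    {u : Eucl n → ℝ → ℝ} {du : Eucl n → ℝ → Eucl n}
    {d2u : Eucl n → ℝ → Fin n → Fin n → ℝ} {ut : Eucl n → ℝ → ℝ}
    (hu : IsClassicalSubsolution a f u du d2u ut) (hs : IsAbsorptionBound a f g h p)
    (hg_pos : ∀ s : ℝ, 0 < s → 0 < g s) (hh_pos : ∀ s : ℝ, 0 < s → 0 < h s)
    (hg_inf : ∀ K : Set ℝ, IsCompact K → K ⊆ Ioi 0 → K.Nonempty → 0 < sInf (g '' K))
    (hh_inf : ∀ K : Set ℝ, IsCompact K → K ⊆ Ioi 0 → K.Nonempty → 0 < sInf (h '' K))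
    (hp_nonneg : ∀ x, 0 ≤ p x) {θ : ℝ} (hθ : 1 < θ)
    (hq_div : ∫⁻ r in Ioi (1 : ℝ), ENNReal.ofReal (r * sInf (p '' ball (0 : Eucl n) r)) = ⊤)
    (hg_int : IntegrableOn
      (fun ζ : ℝ => (Real.sqrt (sInf (g '' Ioo (ζ / θ) (θ * ζ)) * ζ))⁻¹) (Ioi 1))
    (hh_int : IntegrableOn (fun ζ : ℝ => (sInf (h '' Ioo (ζ / θ) (θ * ζ)))⁻¹) (Ioi 1))
    (r₀ : ℝ) {ε : ℝ} (hε : 0 < ε) :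
    ∃ T : ℝ, ∀ x : Eucl n, ‖x‖ ≤ r₀ → ∀ t, T ≤ t → u x t ≤ ε := by
  obtain ⟨c, hc, hcθ⟩ := exists_between hθ
  have hc' : 0 < c - 1 := sub_pos.2 hc
  obtain ⟨η', η'', E, hE, hη, hη', hη'', hη'0, hη'E, hη''E, -⟩ :=
    Real.exists_smoothTransition_deriv_bounds
  set b : ℕ → ℝ := fun k => ε * c ^ k with hbdef
  set G : ℕ → ℝ := fun k => sInf (g '' Icc (b k) (c * b k)) with hGdef
  set H : ℕ → ℝ := fun k => sInf (h '' Icc (b k) (c * b k)) with hHdef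
  have hb : ∀ k, 0 < b k := fun k => by positivity
  have hbs : ∀ k, b (k + 1) = c * b k := fun k => by simp only [hbdef, pow_succ]; ring
  have hdiff : ∀ k, b (k + 1) - b k = (c - 1) * b k := fun k => by rw [hbs]; ring
  have hsub : ∀ k, Icc (b k) (c * b k) ⊆ Ioi 0 := fun k z hz => (hb k).trans_le hz.1
  have hne : ∀ k, (Icc (b k) (c * b k)).Nonempty := fun k =>
    ⟨_, left_mem_Icc.2 (le_mul_of_one_le_left (hb k).le hc.le)⟩
  have hG : ∀ k, 0 < G k := fun k => hg_inf _ isCompact_Icc (hsub k) (hne k)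
  have hH : ∀ k, 0 < H k := fun k => hh_inf _ isCompact_Icc (hsub k) (hne k)
  set X : ℕ → ℝ := fun k => b k / H k with hX
  set Y : ℕ → ℝ := fun k => b k / G k with hY
  have hX0 : ∀ k, 0 < X k := fun k => div_pos (hb k) (hH k)
  have hY0 : ∀ k, 0 < Y k := fun k => div_pos (hb k) (hG k)
  have hX_sum : Summable X := summable_div_sInf hh_pos hh_inf hh_int hc hcθ hε
  have hsqrt_sum : Summable fun k => √(Y k) :=
    summable_sqrt_div_sInf hg_pos hg_inf hg_int hc hcθ hε
  have hY_sum : Summable Y := by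
    refine (hsqrt_sum.mul_of_nonneg hsqrt_sum (fun _ => Real.sqrt_nonneg _)
      fun _ => Real.sqrt_nonneg _).comp_injective (i := fun k => (k, k))
      (fun _ _ hij => congrArg Prod.fst hij) |>.congr fun k => ?_
    exact Real.mul_self_sqrt (hY0 k).le
  have hA : 0 < (c - 1) * E := mul_pos hc' hE
  set A : ℝ := (c - 1) * E with hAdef
  set D : ℕ → ℝ := fun k => 2 * A * X k + 12 * A * Y k + √(8 * A) * √(Y k) with hD
  have hD0 : ∀ k, 0 < D k := fun k => by
    have := hX0 k
    have := hY0 k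
    positivity
  have hD_sum : Summable D :=
    ((hX_sum.mul_left _).add (hY_sum.mul_left _)).add (hsqrt_sum.mul_left _)
  obtain ⟨R, q₀, Φ, Φ', Φ'', hΦ, hrR, hΦ0, hΦR, hq₀, hq₀p⟩ :=
    exists_radialClock hp_nonneg hq_div r₀ (∑' k, D k)
  have hd0 : ∀ k, 0 < 2 * (c - 1) / q₀ * Y k := fun k => by
    have := hY0 k
    positivity
  refine ⟨1 + ∑' k, 2 * (c - 1) / q₀ * Y k, fun x hx t ht => ?_⟩
  have hmem : ∀ k, ∀ ζ ∈ Ioc (b k) (b (k + 1)), ζ ∈ Icc (b k) (c * b k) := fun k ζ hζ =>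
    ⟨hζ.1.le, hζ.2.trans_eq (hbs k)⟩
  have key := hu.le_of_levels hs hΦ hη hη' hη'' hη'0 hη'E hη''E (G := G) (H := H) hb
    (fun k => sub_pos.1 (by rw [hdiff]; exact mul_pos hc' (hb k)))
    ((tendsto_pow_atTop_atTop_of_one_lt hc).const_mul_atTop hε) hD0 hd0 hD_sum
    (hY_sum.mul_left _) hΦR hq₀p
    (fun k ζ hζ => sInf_image_Icc_le hh_pos (hb k) (hmem k ζ hζ))
    (fun k ζ hζ => sInf_image_Icc_le hg_pos (hb k) (hmem k ζ hζ)) (fun k => (hG k).le)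
    (fun k => ?_) (fun k => ?_) (fun k => ?_) x (hx.trans hrR) (hΦ0 x hx) t ht
  · simpa [hbdef] using key
  · have h1 : b k = X k * H k := (div_mul_cancel₀ _ (hH k).ne').symm
    have h2 : 2 * A * X k ≤ D k := by
      have := hY0 k
      have : 0 ≤ 12 * A * Y k + √(8 * A) * √(Y k) := by positivity
      simp only [hD]
      linarith
    rw [hdiff, div_le_iff₀ (hD0 k)]
    calc 2 * ((c - 1) * b k) * E = H k * (2 * A * X k) := by rw [hAdef, h1]; ring
      _ ≤ H k * D k := by have := hH k; gcongr
  · have h1 : b k = Y k * G k := (div_mul_cancel₀ _ (hG k).ne').symm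
    have hXk := hX0 k
    have hYk := hY0 k
    have h2 : 12 * A * Y k ≤ D k := by
      have : 0 ≤ 2 * A * X k + √(8 * A) * √(Y k) := by positivity
      simp only [hD]
      linarith
    have h3 : 8 * A * Y k ≤ D k ^ 2 := by
      have h4 : √(8 * A) * √(Y k) ≤ D k := le_add_of_nonneg_left (by positivity)
      calc 8 * A * Y k = (√(8 * A) * √(Y k)) ^ 2 := by
            rw [mul_pow, Real.sq_sqrt (by positivity), Real.sq_sqrt hYk.le]
        _ ≤ D k ^ 2 := by gcongr
    have h5 : 6 * A * Y k / D k ≤ 1 / 2 := by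
      rw [div_le_iff₀ (hD0 k)]
      linarith
    have h6 : 4 * A * Y k / D k ^ 2 ≤ 1 / 2 := by
      rw [div_le_iff₀ (pow_pos (hD0 k) 2)]
      linarith
    rw [hdiff]
    calc (c - 1) * b k * E * (6 / D k + 4 / D k ^ 2)
        = G k * (6 * A * Y k / D k + 4 * A * Y k / D k ^ 2) := by rw [hAdef, h1]; ring
      _ ≤ G k * 1 := mul_le_mul_of_nonneg_left (by linarith) (hG k).le
      _ = G k := mul_one _
  · have h1 : b k = Y k * G k := (div_mul_cancel₀ _ (hG k).ne').symm
    have h2 : (c - 1) * b k / (2 * (c - 1) / q₀ * Y k) = q₀ * G k / 2 := by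
      have := (hY0 k).ne'
      rw [h1]
      field_simp
    rw [hdiff, h2]
    exact half_lt_self (mul_pos hq₀ (hG k))

/-- **Theorem 2.2.** If `u` is a classical solution of the parabolic inequality
`∂u/∂t − Σ aᵢⱼ(x,u) ∂²u/∂xᵢ∂xⱼ + f(x,u,Du) ≤ 0` in `ℝⁿ × (0,∞)` under the structural
assumptions on `aᵢⱼ, f, g, h, p`, and for some `θ > 1` the integral conditions
`∫₁^∞ r q(r) dr = ∞`, `∫₁^∞ (g_θ(ζ)ζ)^{-1/2} dζ < ∞`, `∫₁^∞ dζ/h_θ(ζ) < ∞` hold,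
then `sup_K u₊(·,t) → 0` as `t → ∞` for every compact `K ⊆ ℝⁿ`. -/
theorem pos_part_stabilizes_to_zero
    (n : ℕ) (hn : 1 ≤ n)
    (a : Eucl n → ℝ → Fin n → Fin n → ℝ)
    (f : Eucl n → ℝ → Eucl n → ℝ)
    (g h : ℝ → ℝ) (p : Eucl n → ℝ)
    -- ellipticity
    (hell : ∀ (x : Eucl n) (ζ : ℝ), ζ ≠ 0 → ∀ ξ : Eucl n, ξ ≠ 0 →
      0 < ∑ i, ∑ j, a x ζ i j * ξ i * ξ j)
    -- g, h : (0,∞) → (0,∞) measurable and locally bounded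
    (hg_meas : Measurable g) (hh_meas : Measurable h)
    (hg_pos : ∀ s : ℝ, 0 < s → 0 < g s) (hh_pos : ∀ s : ℝ, 0 < s → 0 < h s)
    (hg_bdd : ∀ K : Set ℝ, IsCompact K → K ⊆ Ioi 0 → BddAbove (g '' K))
    (hh_bdd : ∀ K : Set ℝ, IsCompact K → K ⊆ Ioi 0 → BddAbove (h '' K))
    -- inf_K g > 0 and inf_K h > 0 on compact subsets of (0,∞)
    (hg_inf : ∀ K : Set ℝ, IsCompact K → K ⊆ Ioi 0 → K.Nonempty → 0 < sInf (g '' K))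
    (hh_inf : ∀ K : Set ℝ, IsCompact K → K ⊆ Ioi 0 → K.Nonempty → 0 < sInf (h '' K))
    -- p : ℝⁿ → [0,∞) measurable and locally bounded
    (hp_meas : Measurable p) (hp_nonneg : ∀ x, 0 ≤ p x)
    (hp_bdd : ∀ K : Set (Eucl n), IsCompact K → BddAbove (p '' K))
    -- the structural condition (1.2)
    (hf : ∀ (x : Eucl n) (ζ : ℝ), ζ ≠ 0 → ∀ lam : ℝ, 0 ≤ lam → lam ≤ p x * h |ζ| →
      p x * g |ζ| * (1 + ∑ i, ∑ j, |a x ζ i j|) ≤ f x ζ (lam • x) * Real.sign ζ)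
    -- θ > 1 and the three integral conditions
    (θ : ℝ) (hθ : 1 < θ)
    (hq_div : ∫⁻ r in Ioi (1 : ℝ), ENNReal.ofReal (r * sInf (p '' ball (0 : Eucl n) r)) = ⊤)
    (hg_int : IntegrableOn
      (fun ζ : ℝ => (Real.sqrt (sInf (g '' Ioo (ζ / θ) (θ * ζ)) * ζ))⁻¹) (Ioi 1))
    (hh_int : IntegrableOn
      (fun ζ : ℝ => (sInf (h '' Ioo (ζ / θ) (θ * ζ)))⁻¹) (Ioi 1))
    -- `u` is a classical solution: its space and time derivatives exist and are continuous
    (u : Eucl n → ℝ → ℝ) (du : Eucl n → ℝ → Eucl n)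
    (d2u : Eucl n → ℝ → Fin n → Fin n → ℝ) (ut : Eucl n → ℝ → ℝ)
    (hdu : ∀ (x : Eucl n) (t : ℝ), 0 < t → ∀ i,
      HasDerivAt (fun s : ℝ => u (x + s • EuclideanSpace.single i (1 : ℝ)) t) (du x t i) 0)
    (hd2u : ∀ (x : Eucl n) (t : ℝ), 0 < t → ∀ i j,
      HasDerivAt (fun s : ℝ => du (x + s • EuclideanSpace.single j (1 : ℝ)) t i) (d2u x t i j) 0)
    (hut : ∀ (x : Eucl n) (t : ℝ), 0 < t → HasDerivAt (fun τ : ℝ => u x τ) (ut x t) t)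
    (hu_cont : ContinuousOn (fun q : Eucl n × ℝ => u q.1 q.2) (univ ×ˢ Ioi 0))
    (hdu_cont : ∀ i, ContinuousOn (fun q : Eucl n × ℝ => du q.1 q.2 i) (univ ×ˢ Ioi 0))
    (hd2u_cont : ∀ i j, ContinuousOn (fun q : Eucl n × ℝ => d2u q.1 q.2 i j) (univ ×ˢ Ioi 0))
    (hut_cont : ContinuousOn (fun q : Eucl n × ℝ => ut q.1 q.2) (univ ×ˢ Ioi 0))
    -- the differential inequality
    (hineq : ∀ (x : Eucl n) (t : ℝ), 0 < t →
      ut x t - (∑ i, ∑ j, a x (u x t) i j * d2u x t i j) + f x (u x t) (du x t) ≤ 0) :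
    ∀ K : Set (Eucl n), IsCompact K →
      Tendsto (fun t : ℝ => sSup ((fun x => max (u x t) 0) '' K)) atTop (nhds 0) := by
  intro K hK
  obtain ⟨r₀, hr₀⟩ := hK.isBounded.exists_norm_le
  have hu : IsClassicalSubsolution a f u du d2u ut :=
    ⟨hdu, hd2u, hut, hu_cont, hdu_cont, hd2u_cont, hineq⟩
  refine Metric.tendsto_atTop.2 fun ε hε => ?_
  obtain ⟨T, hT⟩ := hu.exists_forall_le ⟨hell, hf⟩ hg_pos hh_pos hg_inf hh_inf hp_nonneg hθ
    hq_div hg_int hh_int r₀ (half_pos hε)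
  refine ⟨T, fun t ht => ?_⟩
  have h0 : 0 ≤ sSup ((fun x => max (u x t) 0) '' K) :=
    Real.sSup_nonneg (by rintro _ ⟨x, -, rfl⟩; exact le_max_right _ _)
  have h1 : sSup ((fun x => max (u x t) 0) '' K) ≤ ε / 2 := by
    refine Real.sSup_le ?_ (half_pos hε).le
    rintro _ ⟨x, hx, rfl⟩
    exact max_le (hT x (hr₀ x hx) t ht) (half_pos hε).le
  rw [Real.dist_0_eq_abs, abs_of_nonneg h0]
  linarith
end
end

section
/- Consider the equation u_t = Δu + b(x,u,Du) − c(x)|u|^{σ−1}u in ℝ₊^{n+1}, where |b(x,ζ,ξ)| ≤ b₀ (1+|x|)^k |ζ|^μ |ξ|^α with b₀ > 0 and c(x) ≥ c₀ (1+|x|)^l with c₀ > 0 for all x ∈ ℝⁿ, ζ ∈ ℝ∖{0}, ξ ∈ ℝⁿ, where α > 0 and μ, σ, k, l are arbitrary real numbers. If min{l − k + α, l + 2} ≥ 0 and σ > max{1, α + μ}, then every classical solution of the equation stabilizes to zero uniformly on every compact subset K of ℝⁿ as t → ∞, i.e. lim_{t→∞} sup_{x∈K} |u(x,t)| = 0.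 -/
open Set Filter MeasureTheory Metric

noncomputable section

theorem IsLocalMax.second_deriv_nonpos_s2 {f f' : ℝ → ℝ} {x a : ℝ} (h : IsLocalMax f x)
    (hf : ∀ᶠ s in nhds x, HasDerivAt f (f' s) s) (hf' : HasDerivAt f' a x) : a ≤ 0 := by
  by_contra! ha
  have hd : deriv f =ᶠ[nhds x] f' := hf.mono fun s hs => hs.deriv
  have hdd : deriv (deriv f) x = a := by rw [hd.deriv_eq, hf'.deriv]
  have hmin : IsLocalMin f x :=
    isLocalMin_of_deriv_deriv_pos (by rwa [hdd]) h.deriv_eq_zero hf.self_of_nhds.continuousAt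
  have hconst : f =ᶠ[nhds x] fun _ => f x := by
    filter_upwards [h, hmin] with s h₁ h₂ using le_antisymm h₁ h₂
  have h0 : deriv f =ᶠ[nhds x] fun _ => 0 := by
    filter_upwards [hconst.eventuallyEq_nhds] with s hs
    rw [hs.deriv_eq, deriv_const]
  rw [h0.deriv_eq, deriv_const] at hdd
  exact ha.ne hdd

theorem HasDerivAt.nonneg_of_le_left {g : ℝ → ℝ} {g' T t : ℝ} (hT : T < t)
    (hg : HasDerivAt g g' t) (h : ∀ s ∈ Ico T t, g s ≤ g t) : 0 ≤ g' := by
  have hs := (hasDerivAt_iff_tendsto_slope.1 hg).mono_left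
    (nhdsWithin_mono t fun (s : ℝ) (hs : s ∈ Iio t) => ne_of_lt hs)
  refine ge_of_tendsto hs ?_
  filter_upwards [Ico_mem_nhdsLT hT] with s hs
  rw [slope_def_field]
  exact div_nonneg_of_nonpos (by linarith [h s hs]) (by linarith [hs.2])

theorem barrier_gradient_term_le {b₀ c₀ α μ σ k l p N κ R r ρ y W U : ℝ}
    (hb₀ : 0 < b₀) (hc₀ : 0 < c₀) (hα : 0 < α) (hkl : k ≤ l + α) (hσ : α + μ < σ)
    (hp : 0 < p) (hpα : α ≤ p * (σ - μ - α)) (hN : 0 < N) (hκ : 0 < κ)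
    (hgrad : 2 * b₀ * (8 * p * κ * R ^ 2) ^ α ≤ c₀ * N ^ (σ - μ - α))
    (hr : 1 ≤ r) (hrR : r ≤ 2 * R) (hρ : 0 ≤ ρ) (hρr : ρ ≤ r) (hy : 0 < y) (hy1 : y ≤ 1)
    (hW : N * y ^ (-p) ≤ W) (hU : W ≤ U) :
    b₀ * r ^ k * U ^ μ * (2 * p * κ * ρ * W / y) ^ α ≤ c₀ * r ^ l * U ^ σ / 2 := by
  have hw : 0 < N * y ^ (-p) := by positivity
  have hW0 : 0 < W := hw.trans_le hW
  have hU0 : 0 < U := hW0.trans_le hU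
  have hr0 : 0 < r := by linarith
  have hR0 : 0 < R := by linarith
  have hUσ : U ^ σ = U ^ μ * U ^ (σ - μ) := by rw [← Real.rpow_add hU0]; ring_nf
  have h1 : W ^ α * (N ^ (σ - μ - α) * y ^ (-α)) ≤ U ^ (σ - μ) := by
    calc W ^ α * (N ^ (σ - μ - α) * y ^ (-α))
        ≤ W ^ α * (N ^ (σ - μ - α) * y ^ (-p * (σ - μ - α))) := by
          gcongr ?_ * (?_ * ?_)
          exact Real.rpow_le_rpow_of_exponent_ge hy hy1 (by linarith)
      _ = W ^ α * (N * y ^ (-p)) ^ (σ - μ - α) := by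
          rw [Real.mul_rpow hN.le (by positivity), Real.rpow_mul hy.le]
      _ ≤ W ^ α * W ^ (σ - μ - α) := by
          gcongr; linarith
      _ = W ^ (σ - μ) := by rw [← Real.rpow_add hW0]; ring_nf
      _ ≤ U ^ (σ - μ) := Real.rpow_le_rpow hW0.le hU (by linarith)
  have h2 : r ^ k * (2 * p * κ * ρ * W / y) ^ α
      ≤ r ^ l * (8 * p * κ * R ^ 2) ^ α * (W ^ α * y ^ (-α)) := by
    calc r ^ k * (2 * p * κ * ρ * W / y) ^ α
        ≤ r ^ (l + α) * (2 * p * κ * r * W / y) ^ α := by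
          gcongr
      _ = r ^ l * (2 * p * κ * r ^ 2) ^ α * (W ^ α * y ^ (-α)) := by
          have e : r ^ α * (2 * p * κ * r * W / y) ^ α
              = (2 * p * κ * r ^ 2) ^ α * (W ^ α * y ^ (-α)) := by
            rw [Real.rpow_neg hy.le, ← Real.inv_rpow hy.le, ← Real.mul_rpow hW0.le (by positivity),
              ← Real.mul_rpow hr0.le (by positivity),
              ← Real.mul_rpow (by positivity) (by positivity)]
            congr 1; field_simp
          rw [Real.rpow_add hr0, mul_assoc, e, ← mul_assoc]
      _ ≤ r ^ l * (8 * p * κ * R ^ 2) ^ α * (W ^ α * y ^ (-α)) := by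
          gcongr ?_ * ?_ ^ α * ?_
          have : r ^ 2 ≤ (2 * R) ^ 2 := by gcongr
          nlinarith [mul_pos hp hκ]
  calc b₀ * r ^ k * U ^ μ * (2 * p * κ * ρ * W / y) ^ α
      = U ^ μ * (b₀ * (r ^ k * (2 * p * κ * ρ * W / y) ^ α)) := by ring
    _ ≤ U ^ μ * (b₀ * (r ^ l * (8 * p * κ * R ^ 2) ^ α * (W ^ α * y ^ (-α)))) := by gcongr
    _ = U ^ μ * r ^ l * W ^ α * y ^ (-α) / 2 * (2 * b₀ * (8 * p * κ * R ^ 2) ^ α) := by ring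
    _ ≤ U ^ μ * r ^ l * W ^ α * y ^ (-α) / 2 * (c₀ * N ^ (σ - μ - α)) := by gcongr
    _ = c₀ * r ^ l * (U ^ μ * (W ^ α * (N ^ (σ - μ - α) * y ^ (-α)))) / 2 := by ring
    _ ≤ c₀ * r ^ l * (U ^ μ * U ^ (σ - μ)) / 2 := by gcongr
    _ = c₀ * r ^ l * U ^ σ / 2 := by rw [hUσ]

theorem barrier_diffusion_term_lt {c₀ σ l p N κ R r y W U ε C : ℝ}
    (hc₀ : 0 < c₀) (hl : -2 ≤ l) (hσ : 1 < σ) (hpσ : 2 ≤ p * (σ - 1)) (hN : 0 < N)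
    (hε : 0 ≤ ε) (hdiff : 8 * R ^ 2 * (κ * C + ε) < c₀ * N ^ (σ - 1))
    (hr : 1 ≤ r) (hrR : r ≤ 2 * R) (hy : 0 < y) (hy1 : y ≤ 1)
    (hW : N * y ^ (-p) ≤ W) (hU : W ≤ U) :
    κ * C * W * y ^ (-2 : ℝ) + ε * W < c₀ * r ^ l * U ^ σ / 2 := by
  have hw : 0 < N * y ^ (-p) := by positivity
  have hW0 : 0 < W := hw.trans_le hW
  have hr0 : 0 < r := by linarith
  have hR0 : 0 < R := by linarith
  have hy2 : 1 ≤ y ^ (-2 : ℝ) := Real.one_le_rpow_of_pos_of_le_one_of_nonpos hy hy1 (by norm_num)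
  have hrl : 1 / (4 * R ^ 2) ≤ r ^ l := by
    calc 1 / (4 * R ^ 2) ≤ 1 / r ^ 2 := by
          gcongr; nlinarith
      _ = r ^ (-2 : ℝ) := by rw [Real.rpow_neg hr0.le]; norm_num
      _ ≤ r ^ l := Real.rpow_le_rpow_of_exponent_le hr hl
  have h1 : N ^ (σ - 1) * y ^ (-2 : ℝ) ≤ W ^ (σ - 1) := by
    calc N ^ (σ - 1) * y ^ (-2 : ℝ) ≤ N ^ (σ - 1) * y ^ (-p * (σ - 1)) := by
          gcongr ?_ * ?_
          exact Real.rpow_le_rpow_of_exponent_ge hy hy1 (by linarith)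
      _ = (N * y ^ (-p)) ^ (σ - 1) := by
          rw [Real.mul_rpow hN.le (by positivity), Real.rpow_mul hy.le]
      _ ≤ W ^ (σ - 1) := Real.rpow_le_rpow hw.le hW (by linarith)
  have h2 : κ * C + ε < c₀ * N ^ (σ - 1) * (1 / (4 * R ^ 2)) / 2 := by
    rw [mul_one_div, div_div, lt_div_iff₀ (by positivity)]
    linarith
  have h3 : W * W ^ (σ - 1) = W ^ σ := by
    rw [← Real.rpow_one_add' hW0.le (by linarith)]; ring_nf
  calc κ * C * W * y ^ (-2 : ℝ) + ε * W
      ≤ W * y ^ (-2 : ℝ) * (κ * C + ε) := by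
        nlinarith [mul_nonneg (mul_nonneg hε hW0.le) (sub_nonneg.2 hy2)]
    _ < W * y ^ (-2 : ℝ) * (c₀ * N ^ (σ - 1) * (1 / (4 * R ^ 2)) / 2) := by gcongr
    _ = c₀ * (1 / (4 * R ^ 2)) * (W * (N ^ (σ - 1) * y ^ (-2 : ℝ))) / 2 := by ring
    _ ≤ c₀ * r ^ l * (W * W ^ (σ - 1)) / 2 := by gcongr
    _ ≤ c₀ * r ^ l * U ^ σ / 2 := by
        rw [h3]
        have := Real.rpow_le_rpow hW0.le hU (by linarith : (0:ℝ) ≤ σ)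
        gcongr

theorem norm_add_smul_single_sq {n : ℕ} (x : Eucl n) (i : Fin n) (s : ℝ) :
    ‖x + s • EuclideanSpace.single i (1 : ℝ)‖ ^ 2 = ‖x‖ ^ 2 + 2 * s * x i + s ^ 2 := by
  rw [norm_add_sq_real, norm_smul, inner_smul_right, EuclideanSpace.inner_single_right]
  simp
  ring

theorem hasDerivAt_barrier_line {N κ p A a s : ℝ} (h : 0 < 1 - κ * (A + 2 * s * a + s ^ 2)) :
    HasDerivAt (fun s : ℝ => N * (1 - κ * (A + 2 * s * a + s ^ 2)) ^ (-p))
      (N * p * κ * (2 * a + 2 * s) * (1 - κ * (A + 2 * s * a + s ^ 2)) ^ (-p - 1)) s := by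
  have h1 : HasDerivAt (fun s : ℝ => 1 - κ * (A + 2 * s * a + s ^ 2))
      (-(κ * (2 * a + 2 * s))) s := by
    have := (((((hasDerivAt_id s).const_mul 2).mul_const a).const_add A).add
      ((hasDerivAt_id s).pow 2)).const_mul κ |>.const_sub 1
    refine this.congr_deriv ?_
    simp
  refine ((h1.rpow_const (p := -p) (Or.inl h.ne')).const_mul N).congr_deriv ?_
  ring

theorem hasDerivAt_barrier_line_deriv {N κ p A a : ℝ} (h : 0 < 1 - κ * A) :
    HasDerivAt (fun s : ℝ => N * p * κ * (2 * a + 2 * s) *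
        (1 - κ * (A + 2 * s * a + s ^ 2)) ^ (-p - 1))
      (N * p * κ * (2 * (1 - κ * A) ^ (-p - 1) +
        4 * a ^ 2 * (p + 1) * κ * (1 - κ * A) ^ (-p - 2))) 0 := by
  have h0 : 0 < 1 - κ * (A + 2 * 0 * a + 0 ^ 2) := by simpa using h
  have h1 := (hasDerivAt_barrier_line (N := 1) (p := p + 1) h0)
  have h2 : HasDerivAt (fun s : ℝ => N * p * κ * (2 * a + 2 * s)) (N * p * κ * 2) 0 := by
    simpa using (((hasDerivAt_id (0 : ℝ)).const_mul 2).const_add (2 * a)).const_mul (N * p * κ)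
  have h3 := h2.mul h1
  have e : -(p + 1) = -p - 1 := by ring
  rw [e] at h3
  refine (h3.congr_deriv ?_).congr_of_eventuallyEq (Eventually.of_forall fun s => ?_)
  · have e2 : -p - 1 - 1 = -p - 2 := by ring
    simp only [e2]
    simp
    ring
  · simp

/-- `v`, with spatial gradient `dv`, pure second derivatives `d2v` and time derivative `vt`, is a
classical function on `ℝⁿ × (0,∞)` that satisfies, wherever it is positive,
`v_t ≤ Δv + b₀(1+|x|)^k v^μ |Dv|^α − c₀(1+|x|)^l v^σ`. -/
structure IsPositiveSubsolution {n : ℕ} (b₀ c₀ α μ σ k l : ℝ) (v : Eucl n → ℝ → ℝ)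
    (dv : Eucl n → ℝ → Eucl n) (d2v : Eucl n → ℝ → Fin n → ℝ) (vt : Eucl n → ℝ → ℝ) : Prop where
  hasDerivAt_space : ∀ x t, 0 < t → ∀ i,
    HasDerivAt (fun s : ℝ => v (x + s • EuclideanSpace.single i (1 : ℝ)) t) (dv x t i) 0
  hasDerivAt_grad : ∀ x t, 0 < t → ∀ i,
    HasDerivAt (fun s : ℝ => dv (x + s • EuclideanSpace.single i (1 : ℝ)) t i) (d2v x t i) 0
  hasDerivAt_time : ∀ x t, 0 < t → HasDerivAt (fun τ : ℝ => v x τ) (vt x t) t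
  continuousOn : ContinuousOn (fun q : Eucl n × ℝ => v q.1 q.2) (univ ×ˢ Ioi 0)
  le : ∀ x t, 0 < t → 0 < v x t →
    vt x t ≤ (∑ i, d2v x t i) + b₀ * (1 + ‖x‖) ^ k * v x t ^ μ * ‖dv x t‖ ^ α
      - c₀ * (1 + ‖x‖) ^ l * v x t ^ σ

theorem hasDerivAt_add_smul_single {n : ℕ} {f : Eucl n → ℝ} {f' : Eucl n → ℝ} {i : Fin n}
    (h : ∀ x, HasDerivAt (fun s : ℝ => f (x + s • EuclideanSpace.single i (1 : ℝ))) (f' x) 0)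
    (x : Eucl n) (s : ℝ) :
    HasDerivAt (fun s : ℝ => f (x + s • EuclideanSpace.single i (1 : ℝ)))
      (f' (x + s • EuclideanSpace.single i (1 : ℝ))) s := by
  have h1 := h (x + s • EuclideanSpace.single i (1 : ℝ))
  rw [← sub_self s] at h1
  refine (h1.comp_sub_const s s).congr_of_eventuallyEq (Eventually.of_forall fun r => ?_)
  simp only [sub_smul]
  congr 1
  abel

theorem spatial_max_derivatives {n : ℕ} {f : Eucl n → ℝ} {df : Eucl n → Eucl n}
    {d2f : Eucl n → Fin n → ℝ} {N κ p : ℝ} {x : Eucl n}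
    (hf : ∀ x i, HasDerivAt (fun s : ℝ => f (x + s • EuclideanSpace.single i (1 : ℝ))) (df x i) 0)
    (hdf : ∀ x i,
      HasDerivAt (fun s : ℝ => df (x + s • EuclideanSpace.single i (1 : ℝ)) i) (d2f x i) 0)
    (hx : 0 < 1 - κ * ‖x‖ ^ 2)
    (hmax : IsLocalMax (fun z => f z - N * (1 - κ * ‖z‖ ^ 2) ^ (-p)) x) :
    df x = (2 * N * p * κ * (1 - κ * ‖x‖ ^ 2) ^ (-p - 1)) • x ∧
    ∑ i, d2f x i ≤ N * p * κ * (2 * n * (1 - κ * ‖x‖ ^ 2) ^ (-p - 1) +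
        4 * ‖x‖ ^ 2 * (p + 1) * κ * (1 - κ * ‖x‖ ^ 2) ^ (-p - 2)) := by
  have key : ∀ i, df x i = 2 * N * p * κ * (1 - κ * ‖x‖ ^ 2) ^ (-p - 1) * x i ∧
      d2f x i ≤ N * p * κ * (2 * (1 - κ * ‖x‖ ^ 2) ^ (-p - 1) +
        4 * x i ^ 2 * (p + 1) * κ * (1 - κ * ‖x‖ ^ 2) ^ (-p - 2)) := by
    intro i
    set L : ℝ → Eucl n := fun s => x + s • EuclideanSpace.single i (1 : ℝ) with hL
    have hLc : Continuous L := by fun_prop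
    have hL0 : L 0 = x := by simp [hL]
    have hm : IsLocalMax (fun s => f (L s) -
        N * (1 - κ * (‖x‖ ^ 2 + 2 * s * x i + s ^ 2)) ^ (-p)) 0 := by
      have h1 : IsLocalMax (fun z => f z - N * (1 - κ * ‖z‖ ^ 2) ^ (-p)) (L 0) := by rwa [hL0]
      have h2 := h1.comp_continuous hLc.continuousAt
      simpa only [Function.comp_def, hL, norm_add_smul_single_sq] using h2
    have hpos : ∀ᶠ s in nhds (0 : ℝ), 0 < 1 - κ * (‖x‖ ^ 2 + 2 * s * x i + s ^ 2) := by
      have hc : ContinuousAt (fun s : ℝ => 1 - κ * (‖x‖ ^ 2 + 2 * s * x i + s ^ 2)) 0 := by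
        fun_prop
      exact hc.eventually_const_lt (by simpa using hx)
    have hd : ∀ᶠ s in nhds (0 : ℝ), HasDerivAt (fun s => f (L s) -
        N * (1 - κ * (‖x‖ ^ 2 + 2 * s * x i + s ^ 2)) ^ (-p))
        (df (L s) i - N * p * κ * (2 * x i + 2 * s) *
          (1 - κ * (‖x‖ ^ 2 + 2 * s * x i + s ^ 2)) ^ (-p - 1)) s := by
      filter_upwards [hpos] with s hs
      exact (hasDerivAt_add_smul_single (fun z => hf z i) x s).sub (hasDerivAt_barrier_line hs)
    constructor
    · have h0 := hm.hasDerivAt_eq_zero hd.self_of_nhds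
      rw [hL0] at h0
      simp only [mul_zero, zero_mul, add_zero, ne_eq, OfNat.ofNat_ne_zero, not_false_eq_true,
        zero_pow] at h0
      linarith
    · have := hm.second_deriv_nonpos_s2 hd ((hdf x i).sub (hasDerivAt_barrier_line_deriv hx))
      linarith
  refine ⟨?_, ?_⟩
  · ext i
    simpa using (key i).1
  · refine (Finset.sum_le_sum fun i _ => (key i).2).trans_eq ?_
    rw [EuclideanSpace.real_norm_sq_eq x, ← Finset.mul_sum, Finset.sum_add_distrib]
    simp only [← Finset.sum_mul, ← Finset.mul_sum]
    simp only [Finset.sum_const, Finset.card_univ, Fintype.card_fin, nsmul_eq_mul]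
    ring

theorem IsPositiveSubsolution.le_barrier {n : ℕ} {b₀ c₀ α μ σ k l : ℝ} {v : Eucl n → ℝ → ℝ}
    {dv : Eucl n → ℝ → Eucl n} {d2v : Eucl n → ℝ → Fin n → ℝ} {vt : Eucl n → ℝ → ℝ}
    (hv : IsPositiveSubsolution b₀ c₀ α μ σ k l v dv d2v vt)
    (hb₀ : 0 < b₀) (hc₀ : 0 < c₀) (hα : 0 < α) (hkl : k ≤ l + α) (hl : -2 ≤ l)
    (hσ1 : 1 < σ) (hσ : α + μ < σ) {p N κ R ε K T T₁ : ℝ}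
    (hp : 0 < p) (hpσ : 2 ≤ p * (σ - 1)) (hpα : α ≤ p * (σ - μ - α)) (hN : 0 < N) (hκ : 0 < κ)
    (hR : 1 ≤ R) (hκR : κ * R ^ 2 < 1) (hε : 0 ≤ ε) (hK : 0 ≤ K) (hT : 0 < T)
    (hdiff : 8 * R ^ 2 * (κ * (p * (2 * n + 4 * (p + 1))) + ε) < c₀ * N ^ (σ - 1))
    (hgrad : 2 * b₀ * (8 * p * κ * R ^ 2) ^ α ≤ c₀ * N ^ (σ - μ - α))
    (hinit : ∀ x, ‖x‖ ≤ R → v x T ≤ (1 + K) * N)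
    (hbdry : ∀ x t, ‖x‖ = R → t ∈ Icc T T₁ → v x t ≤ N * (1 - κ * R ^ 2) ^ (-p))
    {x : Eucl n} {t : ℝ} (hx : ‖x‖ ≤ R) (ht : t ∈ Icc T T₁) :
    v x t ≤ (1 + K * Real.exp (-ε * (t - T))) * N * (1 - κ * ‖x‖ ^ 2) ^ (-p) := by
  set θ : ℝ → ℝ := fun t => 1 + K * Real.exp (-ε * (t - T)) with hθ
  have hθ1 : ∀ t, 1 ≤ θ t := fun t => by
    have := mul_nonneg hK (Real.exp_pos (-ε * (t - T))).le
    simp only [hθ]; linarith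
  have hy : ∀ z : Eucl n, ‖z‖ ≤ R → 0 < 1 - κ * ‖z‖ ^ 2 := fun z hz => by
    have : κ * ‖z‖ ^ 2 ≤ κ * R ^ 2 := by gcongr
    linarith
  have hy1 : ∀ z : Eucl n, 1 - κ * ‖z‖ ^ 2 ≤ 1 := fun z => by
    have : 0 ≤ κ * ‖z‖ ^ 2 := by positivity
    linarith
  have hw : ∀ z : Eucl n, ‖z‖ ≤ R → 1 ≤ (1 - κ * ‖z‖ ^ 2) ^ (-p) := fun z hz =>
    Real.one_le_rpow_of_pos_of_le_one_of_nonpos (hy z hz) (hy1 z) (by linarith)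
  set g : Eucl n × ℝ → ℝ := fun q => v q.1 q.2 - θ q.2 * N * (1 - κ * ‖q.1‖ ^ 2) ^ (-p) with hg
  have hgc : ContinuousOn g (closedBall 0 R ×ˢ Icc T T₁) := by
    refine (hv.continuousOn.mono ?_).sub (ContinuousOn.mul ?_ ?_)
    · exact prod_mono (subset_univ _) fun s hs => hT.trans_le hs.1
    · fun_prop
    · refine ContinuousOn.rpow_const (by fun_prop) fun q hq => Or.inl (hy q.1 ?_).ne'
      simpa using hq.1
  obtain ⟨⟨x₀, t₀⟩, ⟨hx₀, ht₀⟩, hmax⟩ :=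
    ((isCompact_closedBall (0 : Eucl n) R).prod isCompact_Icc).exists_isMaxOn
      ⟨(x, t), by simpa using hx, ht⟩ hgc
  suffices h : g (x₀, t₀) ≤ 0 by
    have h1 : g (x, t) ≤ 0 := (hmax ⟨by simpa using hx, ht⟩).trans h
    exact sub_nonpos.1 h1
  by_contra! hpos
  simp only [mem_closedBall, dist_zero_right] at hx₀
  simp only at ht₀
  set y := 1 - κ * ‖x₀‖ ^ 2 with hydef
  have hy0 : 0 < y := hy x₀ hx₀
  have hw0 : 1 ≤ y ^ (-p) := hw x₀ hx₀
  set W := θ t₀ * N * y ^ (-p) with hWdef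
  have hpos' : W < v x₀ t₀ := by simpa [hg] using hpos
  have hWw : N * y ^ (-p) ≤ W := by
    rw [hWdef, mul_assoc]
    exact le_mul_of_one_le_left (by positivity) (hθ1 t₀)
  have hW0 : 0 < W := lt_of_lt_of_le (by positivity) hWw
  have hTt : T < t₀ := by
    refine lt_of_le_of_ne ht₀.1 fun h => ?_
    subst h
    have h1 := hinit x₀ hx₀
    have h2 : θ T = 1 + K := by simp [hθ]
    rw [hWdef, h2] at hpos'
    have h3 : (1 + K) * N * 1 ≤ (1 + K) * N * y ^ (-p) := by gcongr
    linarith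
  have ht0 : 0 < t₀ := hT.trans hTt
  have hxR : ‖x₀‖ < R := by
    refine lt_of_le_of_ne hx₀ fun h => ?_
    have h1 := hbdry x₀ t₀ h ht₀
    rw [← h] at h1
    linarith
  have hloc : IsLocalMax (fun z => v z t₀ - θ t₀ * N * (1 - κ * ‖z‖ ^ 2) ^ (-p)) x₀ := by
    have : ball (0 : Eucl n) R ∈ nhds x₀ := isOpen_ball.mem_nhds (by simpa using hxR)
    filter_upwards [this] with z hz
    exact hmax (a := (z, t₀)) ⟨ball_subset_closedBall hz, ht₀⟩
  obtain ⟨hD, hD2⟩ := spatial_max_derivatives (fun z i => hv.hasDerivAt_space z t₀ ht0 i)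
    (fun z i => hv.hasDerivAt_grad z t₀ ht0 i) hy0 hloc
  rw [← hydef] at hD hD2
  have hvt : -(ε * W) ≤ vt x₀ t₀ := by
    have h1 : HasDerivAt θ (-ε * (θ t₀ - 1)) t₀ := by
      have := ((((hasDerivAt_id t₀).sub_const T).const_mul (-ε)).exp.const_mul K).const_add 1
      refine this.congr_deriv ?_
      simp [hθ]; ring
    have h2 := (hv.hasDerivAt_time x₀ t₀ ht0).sub ((h1.mul_const N).mul_const (y ^ (-p)))
    have h3 := h2.nonneg_of_le_left hTt fun s hs =>
      hmax (a := (x₀, s)) ⟨by simpa using hx₀, hs.1, hs.2.le.trans ht₀.2⟩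
    have h4 : 0 ≤ ε * (N * y ^ (-p)) := by positivity
    rw [hWdef]
    linarith
  have hnorm : ‖dv x₀ t₀‖ = 2 * p * κ * ‖x₀‖ * W / y := by
    have h1 := hθ1 t₀
    rw [hD, norm_smul, Real.norm_of_nonneg (by positivity), Real.rpow_sub_one hy0.ne', hWdef]
    ring
  have hD2' : ∑ i, d2v x₀ t₀ i ≤ κ * (p * (2 * n + 4 * (p + 1))) * W * y ^ (-2 : ℝ) := by
    have h1 := hθ1 t₀
    have e1 : y ^ (-p - 1) ≤ y ^ (-p - 2) :=
      Real.rpow_le_rpow_of_exponent_ge hy0 (hy1 x₀) (by linarith)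
    have e2 : ‖x₀‖ ^ 2 * κ ≤ 1 := by linarith
    have e3 : y ^ (-p - 2) = y ^ (-p) * y ^ (-2 : ℝ) := by rw [← Real.rpow_add hy0]; ring_nf
    calc _ ≤ _ := hD2
      _ = θ t₀ * N * p * κ * (2 * n * y ^ (-p - 1) +
            4 * (p + 1) * (‖x₀‖ ^ 2 * κ) * y ^ (-p - 2)) := by ring
      _ ≤ θ t₀ * N * p * κ * (2 * n * y ^ (-p - 2) + 4 * (p + 1) * 1 * y ^ (-p - 2)) := by
          gcongr
      _ = _ := by rw [e3, hWdef]; ring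
  have hsub := hv.le x₀ t₀ ht0 (hW0.trans hpos')
  rw [hnorm] at hsub
  have hx0 := norm_nonneg x₀
  have hA := barrier_diffusion_term_lt (r := 1 + ‖x₀‖) hc₀ hl hσ1 hpσ hN hε hdiff
    (by linarith) (by linarith) hy0 (hy1 x₀) hWw hpos'.le
  have hB := barrier_gradient_term_le (r := 1 + ‖x₀‖) (ρ := ‖x₀‖) hb₀ hc₀ hα hkl hσ hp hpα hN hκ
    hgrad (by linarith) (by linarith) hx0 (by linarith) hy0 (hy1 x₀) hWw hpos'.le
  linarith

theorem IsPositiveSubsolution.le_barrier_half {n : ℕ} {b₀ c₀ α μ σ k l : ℝ} {v : Eucl n → ℝ → ℝ}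
    {dv : Eucl n → ℝ → Eucl n} {d2v : Eucl n → ℝ → Fin n → ℝ} {vt : Eucl n → ℝ → ℝ}
    (hv : IsPositiveSubsolution b₀ c₀ α μ σ k l v dv d2v vt)
    (hb₀ : 0 < b₀) (hc₀ : 0 < c₀) (hα : 0 < α) (hkl : k ≤ l + α) (hl : -2 ≤ l)
    (hσ1 : 1 < σ) (hσ : α + μ < σ) {p N τ R ε K T T₁ : ℝ}
    (hp : 0 < p) (hpσ : 2 ≤ p * (σ - 1)) (hpα : α ≤ p * (σ - μ - α)) (hN : 0 < N) (hτ : 0 < τ)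
    (hτ1 : τ < 1) (hR : 1 ≤ R) (hε : 0 ≤ ε) (hK : 0 ≤ K) (hT : 0 < T)
    (hdiff : 8 * (τ * (p * (2 * n + 4 * (p + 1))) + ε) < c₀ * N ^ (σ - 1))
    (hgrad : 2 * b₀ * (8 * p * τ) ^ α ≤ c₀ * N ^ (σ - μ - α))
    (hinit : ∀ x, ‖x‖ ≤ 2 * R → v x T ≤ (1 + K) * N)
    (hbdry : ∀ x t, ‖x‖ = 2 * R → t ∈ Icc T T₁ → v x t ≤ N * (1 - τ) ^ (-p))
    {x : Eucl n} {t : ℝ} (hx : ‖x‖ ≤ R) (ht : t ∈ Icc T T₁) :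
    v x t ≤ (1 + K * Real.exp (-(ε / (2 * R) ^ 2) * (t - T))) * N * (1 - τ / 4) ^ (-p) := by
  have hR2 : (0 : ℝ) < (2 * R) ^ 2 := by positivity
  have hκ : τ / (2 * R) ^ 2 * (2 * R) ^ 2 = τ := div_mul_cancel₀ _ hR2.ne'
  have h := hv.le_barrier hb₀ hc₀ hα hkl hl hσ1 hσ (κ := τ / (2 * R) ^ 2) (R := 2 * R)
    (ε := ε / (2 * R) ^ 2) hp hpσ hpα hN (by positivity) (by linarith) (by rwa [hκ])
    (by positivity) hK hT
    (by
      refine lt_of_eq_of_lt ?_ hdiff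
      field_simp)
    (by rwa [mul_assoc (8 * p), hκ]) hinit (by rwa [hκ]) (hx.trans (by linarith)) ht
  refine h.trans ?_
  gcongr ?_ * ?_
  refine Real.rpow_le_rpow_of_nonpos (by linarith) ?_ (by linarith)
  have : τ / (2 * R) ^ 2 * ‖x‖ ^ 2 ≤ τ / (2 * R) ^ 2 * R ^ 2 := by gcongr
  have e : τ / (2 * R) ^ 2 * R ^ 2 = τ / 4 := by field_simp; norm_num
  linarith

/-- On every ball `v(·,t) ≤ m` for all large `t`. -/
def EventuallyLocallyLE {n : ℕ} (v : Eucl n → ℝ → ℝ) (m : ℝ) : Prop :=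
  ∀ R : ℝ, 1 ≤ R → ∃ T : ℝ, 0 < T ∧ ∀ t, T ≤ t → ∀ x, ‖x‖ ≤ R → v x t ≤ m

theorem exists_one_add_exp_decay_le {K ε q : ℝ} (hε : 0 < ε) (hq : 1 < q) (T : ℝ) :
    ∃ T' : ℝ, T ≤ T' ∧ ∀ t, T' ≤ t → 1 + K * Real.exp (-ε * (t - T)) ≤ q := by
  have h1 : Tendsto (fun t : ℝ => ε * (t - T)) atTop atTop :=
    (tendsto_atTop_add_const_right _ (-T) tendsto_id).const_mul_atTop hε
  have h2 : Tendsto (fun t : ℝ => 1 + K * Real.exp (-ε * (t - T))) atTop (nhds 1) := by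
    simpa [Function.comp_def] using
      ((Real.tendsto_exp_neg_atTop_nhds_zero.comp h1).const_mul K).const_add 1
  obtain ⟨T', hT'⟩ := eventually_atTop.1 (h2.eventually (eventually_le_nhds hq))
  exact ⟨max T T', le_max_left _ _, fun t ht => hT' t ((le_max_right _ _).trans ht)⟩

theorem exists_barrier_exponent {α β γ : ℝ} (hβ : 0 < β) (hγ : 0 < γ) :
    ∃ p : ℝ, 0 < p ∧ 2 ≤ p * β ∧ α ≤ p * γ :=
  ⟨max (2 / β) (α / γ), (div_pos two_pos hβ).trans_le (le_max_left _ _),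
    (div_le_iff₀ hβ).1 (le_max_left _ _), (div_le_iff₀ hγ).1 (le_max_right _ _)⟩

theorem IsPositiveSubsolution.exists_eventuallyLocallyLE {n : ℕ} {b₀ c₀ α μ σ k l : ℝ}
    {v : Eucl n → ℝ → ℝ}
    {dv : Eucl n → ℝ → Eucl n} {d2v : Eucl n → ℝ → Fin n → ℝ} {vt : Eucl n → ℝ → ℝ}
    (hv : IsPositiveSubsolution b₀ c₀ α μ σ k l v dv d2v vt)
    (hb₀ : 0 < b₀) (hc₀ : 0 < c₀) (hα : 0 < α) (hkl : k ≤ l + α) (hl : -2 ≤ l)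
    (hσ1 : 1 < σ) (hσ : α + μ < σ) : ∃ m, EventuallyLocallyLE v m := by
  obtain ⟨p, hp, hpσ, hpα⟩ :=
    exists_barrier_exponent (α := α) (sub_pos.2 hσ1) (by linarith : 0 < σ - μ - α)
  set C : ℝ := p * (2 * n + 4 * (p + 1)) with hC
  have hC0 : 0 < C := by positivity
  obtain ⟨N, hN, hN1, hN2⟩ : ∃ N : ℝ, 0 < N ∧ 16 * C < c₀ * N ^ (σ - 1) ∧
      2 * b₀ * (8 * p) ^ α ≤ c₀ * N ^ (σ - μ - α) :=
    ((eventually_gt_atTop 0).and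
      ((((tendsto_rpow_atTop (sub_pos.2 hσ1)).const_mul_atTop hc₀).eventually_gt_atTop _).and
      (((tendsto_rpow_atTop (by linarith)).const_mul_atTop hc₀).eventually_ge_atTop _))).exists
  refine ⟨2 * N * (3 / 4) ^ (-p), fun R hR => ?_⟩
  have hbdd : ∀ T₁ : ℝ, ∃ V, ∀ x t, ‖x‖ ≤ 2 * R → t ∈ Icc 1 T₁ → v x t ≤ V := fun T₁ => by
    obtain ⟨V, hV⟩ := ((isCompact_closedBall (0 : Eucl n) (2 * R)).prod
      (isCompact_Icc (a := (1 : ℝ)) (b := T₁))).bddAbove_image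
      (hv.continuousOn.mono (prod_mono (subset_univ _) fun s hs => one_pos.trans_le hs.1))
    exact ⟨V, fun x t hx ht => hV ⟨(x, t), ⟨by simpa using hx, ht⟩, rfl⟩⟩
  obtain ⟨V, hV⟩ := hbdd 1
  obtain ⟨T, hT1, hT⟩ := exists_one_add_exp_decay_le (K := |V| / N) (q := 2)
    (show 0 < C / (2 * R) ^ 2 by positivity) one_lt_two 1
  refine ⟨T, by linarith, fun t ht x hx => ?_⟩
  obtain ⟨V₁, hV₁⟩ := hbdd t
  obtain ⟨Z, hZ1, hZ⟩ : ∃ Z : ℝ, 1 < Z ∧ V₁ ≤ N * Z ^ p :=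
    ((eventually_gt_atTop 1).and
      (((tendsto_rpow_atTop hp).const_mul_atTop hN).eventually_ge_atTop _)).exists
  have hZi : Z⁻¹ < 1 := inv_lt_one_of_one_lt₀ hZ1
  have hZp : 0 < Z⁻¹ := by positivity
  have h := hv.le_barrier_half hb₀ hc₀ hα hkl hl hσ1 hσ (τ := 1 - Z⁻¹) (K := |V| / N) (ε := C)
    hp hpσ hpα hN (by linarith) (by linarith) hR hC0.le (by positivity) one_pos
    (by
      have : 0 < Z⁻¹ * C := by positivity
      rw [← hC]; linarith)
    (by
      have h0 : 0 ≤ 8 * p * (1 - Z⁻¹) := mul_nonneg (by positivity) (by linarith)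
      have h1 : 8 * p * (1 - Z⁻¹) ≤ 8 * p :=
        mul_le_of_le_one_right (by positivity) (by linarith)
      exact (mul_le_mul_of_nonneg_left (Real.rpow_le_rpow h0 h1 hα.le) (by positivity)).trans hN2)
    (by
      intro z hz
      rw [add_mul, div_mul_cancel₀ _ hN.ne']
      linarith [hV z 1 hz (by simp), le_abs_self V])
    (by
      intro z s hz hs
      rw [sub_sub_cancel, Real.inv_rpow (by positivity), Real.rpow_neg (by positivity), inv_inv]
      exact (hV₁ z s hz.le hs).trans hZ)
    hx ⟨hT1.trans ht, le_rfl⟩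
  have h1 := hT t ht
  have h2 : (1 - (1 - Z⁻¹) / 4) ^ (-p) ≤ (3 / 4 : ℝ) ^ (-p) :=
    Real.rpow_le_rpow_of_nonpos (by norm_num) (by linarith) (by linarith)
  have h3 : 0 ≤ (1 - (1 - Z⁻¹) / 4) ^ (-p) := Real.rpow_nonneg (by linarith) _
  refine h.trans ?_
  gcongr

theorem IsPositiveSubsolution.exists_contraction {n : ℕ} {b₀ c₀ α μ σ k l : ℝ}
    {v : Eucl n → ℝ → ℝ}
    {dv : Eucl n → ℝ → Eucl n} {d2v : Eucl n → ℝ → Fin n → ℝ} {vt : Eucl n → ℝ → ℝ}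
    (hv : IsPositiveSubsolution b₀ c₀ α μ σ k l v dv d2v vt)
    (hb₀ : 0 < b₀) (hc₀ : 0 < c₀) (hα : 0 < α) (hkl : k ≤ l + α) (hl : -2 ≤ l)
    (hσ1 : 1 < σ) (hσ : α + μ < σ) {M : ℝ} (hM : 0 < M) :
    ∃ q : ℝ, 0 < q ∧ q < 1 ∧
      ∀ m, M ≤ m → EventuallyLocallyLE v m → EventuallyLocallyLE v (q * m) := by
  obtain ⟨p, hp, hpσ, hpα⟩ :=
    exists_barrier_exponent (α := α) (sub_pos.2 hσ1) (by linarith : 0 < σ - μ - α)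
  set C : ℝ := p * (2 * n + 4 * (p + 1)) with hC
  have hC0 : 0 < C := by positivity
  set N₀ : ℝ := M * (1 / 2) ^ p with hN₀
  have hN₀0 : 0 < N₀ := by positivity
  obtain ⟨τ, hτ1, hτ2, hτ, hτ0⟩ : ∃ τ : ℝ, 16 * C * τ < c₀ * N₀ ^ (σ - 1) ∧
      2 * b₀ * (8 * p * τ) ^ α ≤ c₀ * N₀ ^ (σ - μ - α) ∧ τ < 1 / 2 ∧ 0 < τ := by
    have h1 : ContinuousAt (fun τ : ℝ => 16 * C * τ) 0 := by fun_prop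
    have h2 : ContinuousAt (fun τ : ℝ => 2 * b₀ * (8 * p * τ) ^ α) 0 := by
      refine ContinuousAt.mul (by fun_prop) (ContinuousAt.rpow_const (by fun_prop) (Or.inr hα.le))
    have h3 : 0 < c₀ * N₀ ^ (σ - 1) := by positivity
    have h4 : 0 < c₀ * N₀ ^ (σ - μ - α) := by positivity
    have e1 := (h1.eventually_lt_const (by simpa using h3)).filter_mono
      (nhdsWithin_le_nhds (s := Ioi 0))
    have e2 := (h2.eventually_lt_const (by simpa [Real.zero_rpow hα.ne'] using h4)).filter_mono
      (nhdsWithin_le_nhds (s := Ioi 0))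
    have e3 : ∀ᶠ τ : ℝ in nhdsWithin 0 (Ioi 0), τ < 1 / 2 :=
      (eventually_lt_nhds (by norm_num)).filter_mono nhdsWithin_le_nhds
    obtain ⟨τ, ⟨⟨f1, f2⟩, f3⟩, f4⟩ :=
      (((e1.and e2).and e3).and self_mem_nhdsWithin).exists
    exact ⟨τ, f1, f2.le, f3, f4⟩
  set q₀ : ℝ := (1 - τ) ^ p * (1 - τ / 4) ^ (-p) with hq₀
  have ha : 0 < 1 - τ := by linarith
  have hb : 0 < 1 - τ / 4 := by linarith
  have hq₀0 : 0 < q₀ := by positivity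
  have hq₀1 : q₀ < 1 := by
    rw [hq₀, Real.rpow_neg hb.le, ← div_eq_mul_inv, div_lt_one (by positivity)]
    exact Real.rpow_lt_rpow ha.le (by linarith) hp
  refine ⟨(1 + q₀) / 2, by positivity, by linarith, fun m hm hE R hR => ?_⟩
  have hm0 : 0 < m := hM.trans_le hm
  obtain ⟨T₀, hT₀, hle⟩ := hE (2 * R) (by linarith)
  set N : ℝ := m * (1 - τ) ^ p with hN
  have hN0 : 0 < N := by positivity
  have hNN : N₀ ≤ N := by
    have : (1 / 2 : ℝ) ^ p ≤ (1 - τ) ^ p := Real.rpow_le_rpow (by norm_num) (by linarith) hp.le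
    rw [hN, hN₀]
    gcongr
  obtain ⟨T, hTT, hT⟩ := exists_one_add_exp_decay_le (K := m / N) (q := (1 + q₀) / 2 / q₀)
    (show 0 < C * τ / (2 * R) ^ 2 by positivity)
    (by rw [lt_div_iff₀ hq₀0]; linarith) T₀
  refine ⟨T, by linarith, fun t ht x hx => ?_⟩
  have h := hv.le_barrier_half hb₀ hc₀ hα hkl hl hσ1 hσ (τ := τ) (K := m / N) (ε := C * τ)
    (N := N) (T₁ := t)
    hp hpσ hpα hN0 hτ0 (by linarith) hR (by positivity) (by positivity) hT₀
    (by
      have : c₀ * N₀ ^ (σ - 1) ≤ c₀ * N ^ (σ - 1) := by gcongr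
      rw [← hC]; linarith)
    (by
      refine hτ2.trans ?_
      gcongr; linarith)
    (by
      intro z hz
      rw [add_mul, div_mul_cancel₀ _ hN0.ne']
      linarith [hle T₀ le_rfl z hz])
    (by
      intro z s hz hs
      rw [hN, mul_assoc, ← Real.rpow_add ha, add_neg_cancel, Real.rpow_zero, mul_one]
      exact hle s hs.1 z hz.le)
    hx ⟨hTT.trans ht, le_rfl⟩
  have h1 := hT t ht
  have h2 : N * (1 - τ / 4) ^ (-p) = q₀ * m := by rw [hN, hq₀]; ring
  rw [mul_assoc, h2] at h
  refine h.trans ?_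
  calc _ ≤ (1 + q₀) / 2 / q₀ * (q₀ * m) := by gcongr
    _ = (1 + q₀) / 2 * m := by field_simp

theorem EventuallyLocallyLE.mono {n : ℕ} {v : Eucl n → ℝ → ℝ} {m m' : ℝ}
    (h : EventuallyLocallyLE v m) (hm : m ≤ m') : EventuallyLocallyLE v m' := fun R hR =>
  let ⟨T, hT, hle⟩ := h R hR
  ⟨T, hT, fun t ht x hx => (hle t ht x hx).trans hm⟩

theorem IsPositiveSubsolution.eventuallyLocallyLE {n : ℕ} {b₀ c₀ α μ σ k l : ℝ}
    {v : Eucl n → ℝ → ℝ}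
    {dv : Eucl n → ℝ → Eucl n} {d2v : Eucl n → ℝ → Fin n → ℝ} {vt : Eucl n → ℝ → ℝ}
    (hv : IsPositiveSubsolution b₀ c₀ α μ σ k l v dv d2v vt)
    (hb₀ : 0 < b₀) (hc₀ : 0 < c₀) (hα : 0 < α) (hkl : k ≤ l + α) (hl : -2 ≤ l)
    (hσ1 : 1 < σ) (hσ : α + μ < σ) {δ : ℝ} (hδ : 0 < δ) : EventuallyLocallyLE v δ := by
  by_contra hcon
  obtain ⟨m, hm⟩ := hv.exists_eventuallyLocallyLE hb₀ hc₀ hα hkl hl hσ1 hσ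
  obtain ⟨q, hq0, hq1, hq⟩ := hv.exists_contraction hb₀ hc₀ hα hkl hl hσ1 hσ hδ
  have hge : ∀ m, EventuallyLocallyLE v m → δ ≤ m := fun m h => by
    by_contra! hlt
    exact hcon (h.mono hlt.le)
  have hpow : ∀ j : ℕ, EventuallyLocallyLE v (q ^ j * m) := fun j => by
    induction j with
    | zero => simpa using hm
    | succ j ih =>
      rw [pow_succ', mul_assoc]
      exact hq _ (hge _ ih) ih
  have hlim : Tendsto (fun j : ℕ => q ^ j * m) atTop (nhds 0) := by
    simpa using (tendsto_pow_atTop_nhds_zero_of_lt_one hq0.le hq1).mul_const m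
  obtain ⟨j, hj⟩ := (hlim.eventually_lt_const hδ).exists
  exact hj.not_ge (hge _ (hpow j))

/-- **Example 2.1.** For the equation `u_t = Δu + b(x,u,Du) − c(x)|u|^{σ−1}u` in
`ℝⁿ × (0,∞)` with `|b(x,ζ,ξ)| ≤ b₀(1+|x|)^k |ζ|^μ |ξ|^α` and `c(x) ≥ c₀(1+|x|)^l`,
if `min{l−k+α, l+2} ≥ 0` and `σ > max{1, α+μ}`, then every classical solution
stabilizes to zero uniformly on every compact subset of `ℝⁿ` as `t → ∞`. -/
theorem example_2_1_stabilization
    (n : ℕ) (hn : 1 ≤ n)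
    (b : Eucl n → ℝ → Eucl n → ℝ) (c : Eucl n → ℝ)
    (b₀ c₀ α μ σ k l : ℝ)
    (hb₀ : 0 < b₀) (hc₀ : 0 < c₀) (hα : 0 < α)
    (hb : ∀ (x : Eucl n) (ζ : ℝ) (ξ : Eucl n), ζ ≠ 0 →
      |b x ζ ξ| ≤ b₀ * (1 + ‖x‖) ^ k * |ζ| ^ μ * ‖ξ‖ ^ α)
    (hc : ∀ x : Eucl n, c₀ * (1 + ‖x‖) ^ l ≤ c x)
    (hmin : 0 ≤ min (l - k + α) (l + 2))
    (hσ : max 1 (α + μ) < σ)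
    -- `u` is a classical solution
    (u : Eucl n → ℝ → ℝ) (du : Eucl n → ℝ → Eucl n)
    (d2u : Eucl n → ℝ → Fin n → Fin n → ℝ) (ut : Eucl n → ℝ → ℝ)
    (hdu : ∀ (x : Eucl n) (t : ℝ), 0 < t → ∀ i,
      HasDerivAt (fun s : ℝ => u (x + s • EuclideanSpace.single i (1 : ℝ)) t) (du x t i) 0)
    (hd2u : ∀ (x : Eucl n) (t : ℝ), 0 < t → ∀ i j,
      HasDerivAt (fun s : ℝ => du (x + s • EuclideanSpace.single j (1 : ℝ)) t i) (d2u x t i j) 0)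
    (hut : ∀ (x : Eucl n) (t : ℝ), 0 < t → HasDerivAt (fun τ : ℝ => u x τ) (ut x t) t)
    (hu_cont : ContinuousOn (fun q : Eucl n × ℝ => u q.1 q.2) (univ ×ˢ Ioi 0))
    (hdu_cont : ∀ i, ContinuousOn (fun q : Eucl n × ℝ => du q.1 q.2 i) (univ ×ˢ Ioi 0))
    (hd2u_cont : ∀ i j, ContinuousOn (fun q : Eucl n × ℝ => d2u q.1 q.2 i j) (univ ×ˢ Ioi 0))
    (hut_cont : ContinuousOn (fun q : Eucl n × ℝ => ut q.1 q.2) (univ ×ˢ Ioi 0))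
    -- the equation `u_t = Δu + b(x,u,Du) − c(x)|u|^{σ−1}u`
    (heq : ∀ (x : Eucl n) (t : ℝ), 0 < t →
      ut x t = (∑ i, d2u x t i i) + b x (u x t) (du x t)
        - c x * |u x t| ^ (σ - 1) * u x t) :
    ∀ K : Set (Eucl n), IsCompact K →
      Tendsto (fun t : ℝ => sSup ((fun x => |u x t|) '' K)) atTop (nhds 0) := by
  intro K hK
  have hl : -2 ≤ l := by linarith [hmin.trans (min_le_right _ _)]
  have hkl : k ≤ l + α := by linarith [hmin.trans (min_le_left _ _)]
  have hσ1 : 1 < σ := (le_max_left _ _).trans_lt hσ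
  have hσ2 : α + μ < σ := (le_max_right _ _).trans_lt hσ
  have hpos : IsPositiveSubsolution b₀ c₀ α μ σ k l u du (fun x t i => d2u x t i i) ut := by
    refine ⟨hdu, fun x t ht i => hd2u x t ht i i, hut, hu_cont, fun x t ht hv => ?_⟩
    have h1 := (le_abs_self _).trans (hb x (u x t) (du x t) hv.ne')
    have h2 := mul_le_mul_of_nonneg_right (hc x) (Real.rpow_nonneg hv.le σ)
    have h3 : u x t ^ (σ - 1) * u x t = u x t ^ σ := by
      rw [Real.rpow_sub_one hv.ne', div_mul_cancel₀ _ hv.ne']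
    rw [heq x t ht, mul_assoc (c x)]
    rw [abs_of_pos hv] at h1 ⊢
    rw [h3]
    linarith
  have hneg : IsPositiveSubsolution b₀ c₀ α μ σ k l (fun x t => -u x t) (fun x t => -du x t)
      (fun x t i => -d2u x t i i) (fun x t => -ut x t) := by
    refine ⟨fun x t ht i => (hdu x t ht i).neg, fun x t ht i => (hd2u x t ht i i).neg,
      fun x t ht => (hut x t ht).neg, hu_cont.neg, fun x t ht hv => ?_⟩
    have hv' : u x t < 0 := neg_pos.1 hv
    have h1 := (neg_le_abs _).trans (hb x (u x t) (du x t) hv'.ne)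
    have h2 := mul_le_mul_of_nonneg_right (hc x) (Real.rpow_nonneg hv.le σ)
    have h3 : (-u x t) ^ (σ - 1) * -u x t = (-u x t) ^ σ := by
      rw [Real.rpow_sub_one hv.ne', div_mul_cancel₀ _ hv.ne']
    rw [heq x t ht, mul_assoc (c x), norm_neg, Finset.sum_neg_distrib]
    rw [abs_of_neg hv'] at h1 ⊢
    rw [← h3] at h2 ⊢
    linarith
  obtain ⟨R, hR⟩ := hK.isBounded.exists_norm_le
  refine Metric.tendsto_atTop.2 fun δ hδ => ?_
  obtain ⟨T₁, -, h₁⟩ := hpos.eventuallyLocallyLE hb₀ hc₀ hα hkl hl hσ1 hσ2 (half_pos hδ)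
    (max 1 R) (le_max_left _ _)
  obtain ⟨T₂, -, h₂⟩ := hneg.eventuallyLocallyLE hb₀ hc₀ hα hkl hl hσ1 hσ2 (half_pos hδ)
    (max 1 R) (le_max_left _ _)
  refine ⟨max T₁ T₂, fun t ht => ?_⟩
  have hle : sSup ((fun x => |u x t|) '' K) ≤ δ / 2 := by
    refine Real.sSup_le ?_ (half_pos hδ).le
    rintro _ ⟨x, hx, rfl⟩
    have hxR : ‖x‖ ≤ max 1 R := (hR x hx).trans (le_max_right _ _)
    exact abs_le'.2 ⟨h₁ t ((le_max_left _ _).trans ht) x hxR,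
      h₂ t ((le_max_right _ _).trans ht) x hxR⟩
  have hge : 0 ≤ sSup ((fun x => |u x t|) '' K) := by
    refine Real.sSup_nonneg ?_
    rintro _ ⟨x, -, rfl⟩
    exact abs_nonneg _
  rw [Real.dist_eq, sub_zero, abs_of_nonneg hge]
  linarith
end
end
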